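/- Let G be a finite connected simple graph. Then I_G is generated by quadratic binomials if and only if the following three conditions hold: (i) every even cycle C of G of length ≥ 6 either has an even-chord or has three odd-chords e, e′, e″ such that e and e′ cross in C; (ii) for any two minimal odd cycles C1 and C2 of G having exactly one common vertex, there exists an edge {i,j} ∈ E(G) \ (E(C1) ∪ E(C2)) with i ∈ V(C1) and j ∈ V(C2); (iii) for any two minimal odd cycles C1 and C2 of G having no common vertex, there exist at least two bridges between C1 and C2. -/

import Mathlib

set_option linter.unusedVariables false

open MvPolynomial

universe uv

/-- The monomial `t_a t_b` associated to an edge `{a,b}`. -/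
noncomputable def edgeMon {V : Type*} (K : Type*) [Field K] (e : Sym2 V) :
    MvPolynomial V K :=
  Sym2.lift ⟨fun a b => X a * X b, fun _ _ => mul_comm _ _⟩ e

/-- The toric ideal `I_G` of a graph `G`: the kernel of the `K`-algebra map
`K[x_e : e ∈ E(G)] → K[t_v : v ∈ V]`, `x_e ↦ t_a t_b` for `e = {a,b}`. -/
noncomputable def toricIdeal {V : Type*} (K : Type*) [Field K] (G : SimpleGraph V) :
    Ideal (MvPolynomial G.edgeSet K) :=
  RingHom.ker (MvPolynomial.aeval (R := K) (fun e : G.edgeSet => edgeMon K e.1))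

/-- `I` is generated by quadratic binomials (differences of two monic monomials
of degree `2`). -/
def IsQuadBinomialGen {σ K : Type*} [Field K] (I : Ideal (MvPolynomial σ K)) : Prop :=
  ∃ S : Set (MvPolynomial σ K), I = Ideal.span S ∧
    ∀ f ∈ S, ∃ i j k l : σ, f = X i * X j - X k * X l

/-- `c` describes a cycle of length `q` in `G`: `q ≥ 3`, the vertices
`c 0, …, c (q-1)` are pairwise distinct, and cyclically consecutive vertices
are adjacent. -/
def IsCycleOn' {V : Type*} (G : SimpleGraph V) (q : ℕ) (c : ZMod q → V) : Prop :=
  3 ≤ q ∧ Function.Injective c ∧ ∀ i, G.Adj (c i) (c (i + 1))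

/-- The set of edges of the cycle described by `c`. -/
def cycEdges {V : Type*} (q : ℕ) (c : ZMod q → V) : Set (Sym2 V) :=
  { e | ∃ i, e = s(c i, c (i + 1)) }

/-- The set of vertices of the cycle described by `c`. -/
def cycVerts {V : Type*} (q : ℕ) (c : ZMod q → V) : Set V := Set.range c

/-- `e` is a chord of the cycle `c` in `G`: an edge of `G` joining two vertices of
the cycle which is not an edge of the cycle. -/
def IsChord {V : Type*} (G : SimpleGraph V) (q : ℕ) (c : ZMod q → V) (e : Sym2 V) : Prop :=
  e ∈ G.edgeSet ∧ e ∉ cycEdges q c ∧ ∃ i j : ZMod q, e = s(c i, c j)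

/-- A chord `{c i, c j}` (`i < j`) of an even cycle is an even-chord if `j - i` is odd. -/
def IsEvenChord {V : Type*} (G : SimpleGraph V) (q : ℕ) (c : ZMod q → V) (e : Sym2 V) : Prop :=
  e ∈ G.edgeSet ∧ e ∉ cycEdges q c ∧
    ∃ i j : ZMod q, i.val < j.val ∧ Odd (j.val - i.val) ∧ e = s(c i, c j)

/-- The pair of positions `i < j` describes an odd-chord (`j - i` even) of the even
cycle `c`. -/
def IsOddChordPair {V : Type*} (G : SimpleGraph V) (q : ℕ) (c : ZMod q → V)
    (i j : ZMod q) : Prop :=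
  i.val < j.val ∧ Even (j.val - i.val) ∧
    s(c i, c j) ∈ G.edgeSet ∧ s(c i, c j) ∉ cycEdges q c

/-- The chords of `c` given by the position pairs `(i,j)` and `(i',j')` cross in `c`. -/
def CrossPairs {V : Type*} (q : ℕ) (c : ZMod q → V) (i j i' j' : ZMod q) : Prop :=
  ((i.val < i'.val ∧ i'.val < j.val ∧ j.val < j'.val) ∨
   (i'.val < i.val ∧ i.val < j'.val ∧ j'.val < j.val)) ∧
  ((s(c i, c i') ∈ cycEdges q c ∧ s(c j, c j') ∈ cycEdges q c) ∨
   (s(c i, c j') ∈ cycEdges q c ∧ s(c j, c i') ∈ cycEdges q c))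

/-- Condition (i) of Proposition 1.2: every even cycle of length `≥ 6` has an
even-chord or three odd-chords `e, e', e''` such that `e` and `e'` cross. -/
def CondEvenCycles {V : Type*} (G : SimpleGraph V) : Prop :=
  ∀ (q : ℕ) (c : ZMod q → V), IsCycleOn' G q c → 6 ≤ q → Even q →
    (∃ e, IsEvenChord G q c e) ∨
    (∃ i j i' j' i'' j'' : ZMod q,
      IsOddChordPair G q c i j ∧ IsOddChordPair G q c i' j' ∧ IsOddChordPair G q c i'' j'' ∧
      s(c i, c j) ≠ s(c i', c j') ∧ s(c i, c j) ≠ s(c i'', c j'') ∧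
      s(c i', c j') ≠ s(c i'', c j'') ∧
      CrossPairs q c i j i' j')

/-- A minimal cycle is a cycle having no chords. -/
def IsMinimalCycle {V : Type*} (G : SimpleGraph V) (q : ℕ) (c : ZMod q → V) : Prop :=
  IsCycleOn' G q c ∧ ∀ e, ¬ IsChord G q c e

/-- Condition (ii) of Proposition 1.2: any two minimal odd cycles sharing exactly one
vertex are joined by an edge of `G` outside both cycles. -/
def CondOddCyclesMeet {V : Type*} (G : SimpleGraph V) : Prop :=
  ∀ (q₁ : ℕ) (c₁ : ZMod q₁ → V) (q₂ : ℕ) (c₂ : ZMod q₂ → V),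
    IsMinimalCycle G q₁ c₁ → Odd q₁ → IsMinimalCycle G q₂ c₂ → Odd q₂ →
    (∃ v, cycVerts q₁ c₁ ∩ cycVerts q₂ c₂ = {v}) →
    ∃ a b, a ∈ cycVerts q₁ c₁ ∧ b ∈ cycVerts q₂ c₂ ∧ G.Adj a b ∧
      s(a, b) ∉ cycEdges q₁ c₁ ∧ s(a, b) ∉ cycEdges q₂ c₂

/-- `e` is a bridge between two vertex-disjoint cycles: an edge of `G` joining a vertex
of the first cycle to a vertex of the second one. -/
def IsBridge' {V : Type*} (G : SimpleGraph V) (q₁ : ℕ) (c₁ : ZMod q₁ → V)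
    (q₂ : ℕ) (c₂ : ZMod q₂ → V) (e : Sym2 V) : Prop :=
  e ∈ G.edgeSet ∧ ∃ a b, a ∈ cycVerts q₁ c₁ ∧ b ∈ cycVerts q₂ c₂ ∧ e = s(a, b)

/-- Condition (iii) of Proposition 1.2: any two vertex-disjoint minimal odd cycles are
joined by at least two bridges. -/
def CondOddCyclesDisjoint {V : Type*} (G : SimpleGraph V) : Prop :=
  ∀ (q₁ : ℕ) (c₁ : ZMod q₁ → V) (q₂ : ℕ) (c₂ : ZMod q₂ → V),
    IsMinimalCycle G q₁ c₁ → Odd q₁ → IsMinimalCycle G q₂ c₂ → Odd q₂ →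
    cycVerts q₁ c₁ ∩ cycVerts q₂ c₂ = ∅ →
    ∃ e₁ e₂ : Sym2 V, e₁ ≠ e₂ ∧
      IsBridge' G q₁ c₁ q₂ c₂ e₁ ∧ IsBridge' G q₁ c₁ q₂ c₂ e₂

/-! ### Alternating products along closed walks -/

/-- The product of the weights `x (f k) (f (k + 1))` over `i ≤ k < j` with `k ≡ e mod 2`. -/
def altProd {V A : Type*} [CommMonoid A] (x : V → V → A) (e : ℕ) (f : ℕ → V) (i j : ℕ) : A :=
  ∏ k ∈ Finset.Ico i j, if k % 2 = e then x (f k) (f (k + 1)) else 1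

section AltProd

variable {V A : Type*} [CommMonoid A] (x : V → V → A)

theorem altProd_mul (e : ℕ) (f : ℕ → V) {i j k : ℕ} (hij : i ≤ j) (hjk : j ≤ k) :
    altProd x e f i j * altProd x e f j k = altProd x e f i k :=
  Finset.prod_Ico_consecutive _ hij hjk

theorem altProd_congr (e : ℕ) {f g : ℕ → V} {i j : ℕ} (h : ∀ k, i ≤ k → k ≤ j → f k = g k) :
    altProd x e f i j = altProd x e g i j := by
  refine Finset.prod_congr rfl fun k hk => ?_
  rw [Finset.mem_Ico] at hk
  rw [h k hk.1 hk.2.le, h (k + 1) (by omega) hk.2]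

theorem altProd_single (e : ℕ) (f : ℕ → V) (i : ℕ) :
    altProd x e f i (i + 1) = if i % 2 = e then x (f i) (f (i + 1)) else 1 := by
  simp [altProd]

theorem altProd_shift_even (e : ℕ) (f : ℕ → V) (i j : ℕ) {d : ℕ} (hd : Even d) :
    altProd x e (fun k => f (k + d)) i j = altProd x e f (i + d) (j + d) := by
  unfold altProd
  rw [← Finset.prod_Ico_add' _ i j d]
  refine Finset.prod_congr rfl fun k _ => ?_
  obtain ⟨c, rfl⟩ := hd
  have : (k + (c + c)) % 2 = k % 2 := by omega
  beta_reduce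
  rw [this, show k + 1 + (c + c) = k + (c + c) + 1 by omega]

theorem altProd_shift_one {e e' : ℕ} (he : e + e' = 1) (f : ℕ → V) (i j : ℕ) :
    altProd x e (fun k => f (k + 1)) i j = altProd x e' f (i + 1) (j + 1) := by
  unfold altProd
  rw [← Finset.prod_Ico_add' _ i j 1]
  refine Finset.prod_congr rfl fun k _ => ?_
  have : k % 2 = e ↔ (k + 1) % 2 = e' := by omega
  simp only [this]

theorem altProd_zero_range (f : ℕ → V) (m : ℕ) :
    altProd x 0 f 0 (2 * m) = ∏ k ∈ Finset.range m, x (f (2 * k)) (f (2 * k + 1)) := by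
  induction m with
  | zero => simp [altProd]
  | succ m ih =>
    rw [Finset.prod_range_succ, ← ih, ← altProd_mul x 0 f (Nat.zero_le (2 * m)) (by omega),
      ← altProd_mul x 0 f (show 2 * m ≤ 2 * m + 1 by omega) (show 2 * m + 1 ≤ 2 * (m + 1) by omega),
      altProd_single, show 2 * (m + 1) = 2 * m + 1 + 1 by ring, altProd_single]
    rw [if_pos (by omega), if_neg (by omega), mul_one]

theorem altProd_one_range (f : ℕ → V) (m : ℕ) :
    altProd x 1 f 0 (2 * m) = ∏ k ∈ Finset.range m, x (f (2 * k + 1)) (f (2 * k + 2)) := by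
  induction m with
  | zero => simp [altProd]
  | succ m ih =>
    rw [Finset.prod_range_succ, ← ih, ← altProd_mul x 1 f (Nat.zero_le (2 * m)) (by omega),
      ← altProd_mul x 1 f (show 2 * m ≤ 2 * m + 1 by omega) (show 2 * m + 1 ≤ 2 * (m + 1) by omega),
      altProd_single, show 2 * (m + 1) = 2 * m + 1 + 1 by ring, altProd_single]
    rw [if_neg (by omega), if_pos (by omega), one_mul]

end AltProd

/-- The vertices `f 0, …, f (2 * n)` form a closed walk of length `2 * n`. -/
structure IsClosedWalk {V : Type*} (G : SimpleGraph V) (n : ℕ) (f : ℕ → V) : Prop where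
  adj : ∀ k < 2 * n, G.Adj (f k) (f (k + 1))
  closed : f (2 * n) = f 0

/-- The two alternating products along the closed walk `f` agree. -/
def IsBalanced {V A : Type*} [CommMonoid A] (x : V → V → A) (n : ℕ) (f : ℕ → V) : Prop :=
  altProd x 0 f 0 (2 * n) = altProd x 1 f 0 (2 * n)

/-- A periodic closed walk of length `2 * n` whose alternating products differ. -/
structure IsUnbalanced {V A : Type*} [CommMonoid A] (G : SimpleGraph V) (x : V → V → A) (n : ℕ)
    (w : ℕ → V) : Prop where
  adj : ∀ k, G.Adj (w k) (w (k + 1))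
  per : ∀ k, w (k + 2 * n) = w k
  ne : ¬ IsBalanced x n w

/-- A periodic closed walk of length `2 * n` without even chords and even repetitions, also
after reversing any of its segments that can be reversed. -/
structure IsRigid {V : Type*} (G : SimpleGraph V) (n : ℕ) (w : ℕ → V) : Prop where
  adj : ∀ k, G.Adj (w k) (w (k + 1))
  per : ∀ k, w (k + 2 * n) = w k
  not_adj : ∀ i d, Odd d → 3 ≤ d → d + 3 ≤ 2 * n → ¬ G.Adj (w i) (w (i + d))
  ne : ∀ i d, Even d → 0 < d → d < 2 * n → w i ≠ w (i + d)
  cross : ∀ i t, Even t → 2 ≤ t → t + 2 ≤ 2 * n → G.Adj (w i) (w (i + t)) →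
    G.Adj (w (i + 1)) (w (i + t + 1)) → ∀ p q, 1 ≤ p → p ≤ t → t + 1 ≤ q → q ≤ 2 * n →
    w (i + p) ≠ w (i + q) ∧ (G.Adj (w (i + p)) (w (i + q)) →
      (p = t ∨ p = 1) ∧ (q = t + 1 ∨ q = 2 * n))

section Unbalanced

variable {V A : Type*} [CommMonoid A] {G : SimpleGraph V} {x : V → V → A} {n : ℕ} {w : ℕ → V}

theorem IsUnbalanced.shift_one (h : IsUnbalanced G x n w) :
    IsUnbalanced G x n (fun k => w (k + 1)) := by
  refine ⟨fun k => h.adj _, fun k => ?_, fun hb => h.ne ?_⟩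
  · rw [← h.per (k + 1)]; congr 1; omega
  · have key : ∀ e, altProd x e w (0 + 1) (2 * n + 1) = altProd x e w 0 (2 * n) := by
      intro e
      rcases Nat.eq_zero_or_pos n with rfl | hn
      · simp [altProd]
      rw [← altProd_mul x e w (show 0 + 1 ≤ 2 * n by omega) (show 2 * n ≤ 2 * n + 1 by omega),
        ← altProd_mul x e w (show 0 ≤ 0 + 1 by omega) (show 0 + 1 ≤ 2 * n by omega),
        altProd_single, altProd_single, mul_comm]
      have h0 := h.per 0
      have h1 := h.per (0 + 1)
      rw [zero_add] at h0
      rw [show 0 + 1 + 2 * n = 2 * n + 1 by omega] at h1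
      rw [h0, h1]
      congr 2
      simp
    unfold IsBalanced at hb ⊢
    rw [altProd_shift_one x (e' := 1) (by rfl), altProd_shift_one x (e' := 0) (by rfl), key,
      key] at hb
    exact hb.symm

theorem IsUnbalanced.shift (h : IsUnbalanced G x n w) (r : ℕ) :
    IsUnbalanced G x n (fun k => w (r + k)) := by
  induction r with
  | zero => simpa using h
  | succ r ih =>
    have := ih.shift_one
    convert this using 3
    omega

theorem IsUnbalanced.ne_zero (h : IsUnbalanced G x n w)
    (ih : ∀ m < n, ∀ f, IsClosedWalk G m f → IsBalanced x m f)
    {d : ℕ} (hd : Even d) (hd0 : 0 < d) (hdn : d < 2 * n) : w 0 ≠ w d := by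
  intro heq
  apply h.ne
  obtain ⟨c, hc⟩ := hd
  have b1 := ih c (by omega) w ⟨fun k _ => h.adj k, by rw [heq]; congr 1; omega⟩
  have b2 := ih (n - c) (by omega) (fun k => w (k + d)) ⟨fun k _ => by
      have := h.adj (k + d); rwa [show k + d + 1 = k + 1 + d by omega] at this, by
      show w (2 * (n - c) + d) = w (0 + d)
      rw [zero_add, ← heq, ← h.per 0]; congr 1; omega⟩
  unfold IsBalanced at b1 b2 ⊢
  rw [altProd_shift_even x _ _ _ _ ⟨c, hc⟩, altProd_shift_even x _ _ _ _ ⟨c, hc⟩, zero_add,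
    show 2 * (n - c) + d = 2 * n by omega] at b2
  rw [show 2 * c = d by omega] at b1
  rw [← altProd_mul x 0 w (Nat.zero_le d) hdn.le, ← altProd_mul x 1 w (Nat.zero_le d) hdn.le,
    b1, b2]

theorem IsUnbalanced.not_adj_zero (h : IsUnbalanced G x n w) (hx : ∀ a b, x a b = x b a)
    (ih : ∀ m < n, ∀ f, IsClosedWalk G m f → IsBalanced x m f)
    {d : ℕ} (hd : Odd d) (hd0 : 3 ≤ d) (hdn : d + 3 ≤ 2 * n) : ¬ G.Adj (w 0) (w d) := by
  intro hadj
  apply h.ne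
  obtain ⟨c, hc⟩ := hd
  have hw2n : w (2 * n) = w 0 := by have := h.per 0; rwa [zero_add] at this
  have b1 := ih (c + 1) (by omega) (fun k => if k ≤ d then w k else w 0) ⟨fun k hk => by
      rcases Nat.lt_or_ge k d with hkd | hkd
      · simpa [hkd.le, Nat.succ_le_of_lt hkd] using h.adj k
      · have : k = d := by omega
        subst this
        simpa using hadj.symm, by
      simp; intro h1; exfalso; omega⟩
  have b2 := ih (n - c) (by omega) (fun k => if k = 0 then w 0 else w (k + 2 * c)) ⟨fun k hk => by
      rcases Nat.eq_zero_or_pos k with rfl | hk0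
      · simpa [show 1 + 2 * c = d by omega] using hadj
      · have := h.adj (k + 2 * c)
        simpa [hk0.ne', show k + 1 + 2 * c = k + 2 * c + 1 by omega] using this, by
      have : n - c ≠ 0 := by omega
      simp only [mul_eq_zero, OfNat.ofNat_ne_zero, false_or, this, if_false, if_true]
      rw [← hw2n]; congr 1; omega⟩
  have e1 : ∀ e, altProd x e (fun k => if k ≤ d then w k else w 0) 0 d = altProd x e w 0 d :=
    fun e => altProd_congr x e fun k _ hk => if_pos hk
  have e2 : ∀ e, altProd x e (fun k => if k = 0 then w 0 else w (k + 2 * c)) 1 (2 * (n - c))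
      = altProd x e w d (2 * n) := by
    intro e
    rw [altProd_congr x e (g := fun k => w (k + 2 * c)) fun k hk _ => if_neg (by omega),
      altProd_shift_even x _ _ _ _ (even_two_mul c)]
    congr 1 <;> omega
  unfold IsBalanced at b1 b2 ⊢
  rw [show 2 * (c + 1) = d + 1 by omega,
    ← altProd_mul x 0 _ (Nat.zero_le d) (Nat.le_succ d),
    ← altProd_mul x 1 _ (Nat.zero_le d) (Nat.le_succ d), altProd_single, altProd_single, e1, e1,
    if_neg (by omega), if_pos (by omega)] at b1
  rw [← altProd_mul x 0 _ (Nat.zero_le 1) (show 1 ≤ 2 * (n - c) by omega),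
    ← altProd_mul x 1 _ (Nat.zero_le 1) (show 1 ≤ 2 * (n - c) by omega),
    altProd_single x 0 _ 0, altProd_single x 1 _ 0, e2, e2] at b2
  simp [show 1 + 2 * c = d by omega] at b1 b2
  rw [← altProd_mul x 0 w (Nat.zero_le d) (show d ≤ 2 * n by omega),
    ← altProd_mul x 1 w (Nat.zero_le d) (show d ≤ 2 * n by omega), b1, ← b2, hx (w d) (w 0),
    mul_assoc]

/-- The walk obtained from `w` by reversing the segment `1, …, t`. -/
def flipWalk {V : Type*} (n t : ℕ) (w : ℕ → V) (k : ℕ) : V :=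
  if 1 ≤ k % (2 * n) ∧ k % (2 * n) ≤ t then w (t + 1 - k % (2 * n)) else w (k % (2 * n))

theorem flipWalk_of_le {V : Type*} {n t : ℕ} (w : ℕ → V) {k : ℕ} (ht : t + 2 ≤ 2 * n)
    (hk : 1 ≤ k) (hkt : k ≤ t) : flipWalk n t w k = w (t + 1 - k) := by
  unfold flipWalk
  rw [Nat.mod_eq_of_lt (by omega), if_pos ⟨hk, hkt⟩]

theorem flipWalk_of_gt {V : Type*} {n t : ℕ} {w : ℕ → V} {k : ℕ} (hw : w (2 * n) = w 0)
    (hk : k = 0 ∨ t + 1 ≤ k) (hkn : k ≤ 2 * n) : flipWalk n t w k = w k := by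
  unfold flipWalk
  rcases hkn.lt_or_eq with h | h
  · rw [Nat.mod_eq_of_lt h, if_neg (by omega)]
  · rw [h, Nat.mod_self, if_neg (by omega), hw]

theorem IsUnbalanced.flip (h : IsUnbalanced G x n w) (hx : ∀ a b, x a b = x b a)
    (hq : ∀ a b c d, G.Adj a b → G.Adj b c → G.Adj c d → G.Adj d a →
      x a b * x c d = x b c * x d a)
    {t : ℕ} (ht : Even t) (ht2 : 2 ≤ t) (htn : t + 2 ≤ 2 * n) (h1 : G.Adj (w 0) (w t))
    (h2 : G.Adj (w 1) (w (t + 1))) : IsUnbalanced G x n (flipWalk n t w) := by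
  have hw2n : w (2 * n) = w 0 := by have := h.per 0; rwa [zero_add] at this
  have f0 : flipWalk n t w 0 = w 0 := flipWalk_of_gt hw2n (Or.inl rfl) (by omega)
  have f1 : flipWalk n t w 1 = w t := flipWalk_of_le w htn le_rfl (by omega)
  have ft : flipWalk n t w t = w 1 := by
    rw [flipWalk_of_le w htn (by omega) le_rfl]; congr 1; omega
  have ft1 : flipWalk n t w (t + 1) = w (t + 1) :=
    flipWalk_of_gt hw2n (Or.inr le_rfl) (by omega)
  have hadj : ∀ k < 2 * n, G.Adj (flipWalk n t w k) (flipWalk n t w (k + 1)) := by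
    intro k hk
    rcases Nat.eq_zero_or_pos k with rfl | hk0
    · rw [f0, f1]; exact h1
    rcases Nat.lt_trichotomy k t with hkt | rfl | hkt
    · rw [flipWalk_of_le w htn hk0 hkt.le, flipWalk_of_le w htn (by omega) hkt]
      have := (h.adj (t - k)).symm
      rwa [show t - k + 1 = t + 1 - k by omega, show t - k = t + 1 - (k + 1) by omega] at this
    · rw [ft, ft1]; exact h2
    · rw [flipWalk_of_gt hw2n (Or.inr hkt) hk.le, flipWalk_of_gt hw2n (by omega) hk]
      exact h.adj k
  have hper : ∀ k, flipWalk n t w (k + 2 * n) = flipWalk n t w k := by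
    intro k; unfold flipWalk; rw [Nat.add_mod_right]
  refine ⟨fun k => ?_, hper, fun hb => h.ne ?_⟩
  · have e1 : flipWalk n t w k = flipWalk n t w (k % (2 * n)) := by
      unfold flipWalk; rw [Nat.mod_mod]
    have e2 : flipWalk n t w (k + 1) = flipWalk n t w (k % (2 * n) + 1) := by
      unfold flipWalk; rw [Nat.mod_add_mod]
    rw [e1, e2]
    exact hadj _ (Nat.mod_lt _ (by omega))
  · have key : ∀ e, altProd x e (flipWalk n t w) 0 (2 * n) = altProd x e w 0 (2 * n) := by
      intro e
      have split : ∀ f : ℕ → V, altProd x e f 0 (2 * n) =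
          (altProd x e f 0 (0 + 1) * altProd x e f t (t + 1)) *
            (altProd x e f 1 t * altProd x e f (t + 1) (2 * n)) := by
        intro f
        rw [← altProd_mul x e f (show 0 ≤ 0 + 1 by omega) (show 0 + 1 ≤ 2 * n by omega),
          ← altProd_mul x e f (show 0 + 1 ≤ t by omega) (show t ≤ 2 * n by omega),
          ← altProd_mul x e f (show t ≤ t + 1 by omega) (show t + 1 ≤ 2 * n by omega)]
        simp only [zero_add]
        ac_rfl
      rw [split, split]
      congr 1
      · rw [altProd_single, altProd_single, altProd_single, altProd_single, zero_add, f0, f1, ft,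
          ft1]
        obtain ⟨c, hc⟩ := ht
        have : t % 2 = 0 % 2 := by omega
        rw [this]
        split_ifs
        · have := hq (w 0) (w t) (w (t + 1)) (w 1) h1 (h.adj t) h2.symm (h.adj 0).symm
          rw [hx (w 1) (w (t + 1)), this, hx (w 1) (w 0), mul_comm]
        · rfl
      · congr 1
        · unfold altProd
          have := Finset.prod_Ico_reflect
            (fun k => if k % 2 = e then x (w k) (w (k + 1)) else 1) 1 (m := t) (n := t) (by omega)
          rw [show t + 1 - t = 1 by omega, show t + 1 - 1 = t by omega] at this
          rw [← this]
          refine Finset.prod_congr rfl fun k hk => ?_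
          rw [Finset.mem_Ico] at hk
          rw [flipWalk_of_le w htn hk.1 hk.2.le, flipWalk_of_le w htn (by omega) hk.2]
          obtain ⟨c, hc⟩ := ht
          have : (t - k) % 2 = k % 2 := by omega
          rw [this, hx, show t + 1 - (k + 1) = t - k by omega,
            show t + 1 - k = t - k + 1 by omega]
        · exact altProd_congr x e fun k hk hk' => flipWalk_of_gt hw2n (Or.inr hk) hk'
    unfold IsBalanced at hb ⊢
    rwa [key, key] at hb

theorem IsUnbalanced.isRigid (h : IsUnbalanced G x n w) (hx : ∀ a b, x a b = x b a)
    (hq : ∀ a b c d, G.Adj a b → G.Adj b c → G.Adj c d → G.Adj d a →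
      x a b * x c d = x b c * x d a)
    (ih : ∀ m < n, ∀ f, IsClosedWalk G m f → IsBalanced x m f) : IsRigid G n w := by
  have hna : ∀ {w : ℕ → V}, IsUnbalanced G x n w → ∀ i d, Odd d → 3 ≤ d → d + 3 ≤ 2 * n →
      ¬ G.Adj (w i) (w (i + d)) := fun h i d h1 h2 h3 =>
    (h.shift i).not_adj_zero hx ih h1 h2 h3
  have hne : ∀ {w : ℕ → V}, IsUnbalanced G x n w → ∀ i d, Even d → 0 < d → d < 2 * n →
      w i ≠ w (i + d) := fun h i d h1 h2 h3 => (h.shift i).ne_zero ih h1 h2 h3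
  refine ⟨h.adj, h.per, hna h, hne h, ?_⟩
  intro i t ht ht2 htn h1 h2 p q hp1 hpt hqt hqn
  have hs := h.shift i
  have hw2n : (fun k => w (i + k)) (2 * n) = (fun k => w (i + k)) 0 := h.per i
  have hf := hs.flip hx hq ht ht2 htn h1 h2
  have fp : flipWalk n t (fun k => w (i + k)) (t + 1 - p) = w (i + p) := by
    rw [flipWalk_of_le _ htn (by omega) (by omega)]
    congr 2; omega
  have fq : flipWalk n t (fun k => w (i + k)) q = w (i + q) :=
    flipWalk_of_gt hw2n (Or.inr hqt) hqn
  rw [← fp, ← fq]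
  obtain ⟨c, hc⟩ := ht
  rcases Nat.even_or_odd (q - p) with hpar | hpar
  · have hodd : Odd (q - (t + 1 - p)) := by
      obtain ⟨b, hb⟩ := hpar
      exact ⟨q - p - b + p - c - 1, by omega⟩
    refine ⟨?_, fun hadj => ?_⟩
    · rw [fp, fq]
      have := hne h (i + p) (q - p) hpar (by omega) (by omega)
      rwa [show i + p + (q - p) = i + q by omega] at this
    · by_contra hcon
      have := hna hf (t + 1 - p) _ hodd (by obtain ⟨b, hb⟩ := hodd; omega)
        (by obtain ⟨b, hb⟩ := hodd; omega)
      rw [show t + 1 - p + (q - (t + 1 - p)) = q by omega] at this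
      exact this hadj
  · have heven : Even (q - (t + 1 - p)) := by
      obtain ⟨b, hb⟩ := hpar
      exact ⟨q - p - b + p - c - 1, by omega⟩
    refine ⟨?_, fun hadj => ?_⟩
    · have := hne hf (t + 1 - p) _ heven (by omega) (by omega)
      rwa [show t + 1 - p + (q - (t + 1 - p)) = q by omega] at this
    · rw [fp, fq] at hadj
      by_contra hcon
      have := hna h (i + p) _ hpar (by obtain ⟨b, hb⟩ := hpar; omega)
        (by obtain ⟨b, hb⟩ := hpar; omega)
      rw [show i + p + (q - p) = i + q by omega] at this
      exact this hadj

end Unbalanced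

/-! ### Odd holes -/

/-- `S` is the vertex set of a minimal odd cycle of `G`. -/
def IsOddHole {V : Type*} (G : SimpleGraph V) (S : Set V) : Prop :=
  ∃ (q : ℕ) (c : ZMod q → V), IsMinimalCycle G q c ∧ Odd q ∧ cycVerts q c = S

section OddHole

variable {V : Type*} {G : SimpleGraph V}

theorem mem_cycEdges_of_isMinimalCycle {q : ℕ} {c : ZMod q → V} (h : IsMinimalCycle G q c)
    {a b : V} (ha : a ∈ cycVerts q c) (hb : b ∈ cycVerts q c) (hab : G.Adj a b) :
    s(a, b) ∈ cycEdges q c := by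
  by_contra hcon
  obtain ⟨i, rfl⟩ := ha
  obtain ⟨j, rfl⟩ := hb
  exact h.2 _ ⟨hab, hcon, i, j, rfl⟩

theorem IsOddHole.exists_adj_of_inter_eq (h : CondOddCyclesMeet G) {S T : Set V}
    (hS : IsOddHole G S) (hT : IsOddHole G T) {v : V} (hST : S ∩ T = {v}) :
    ∃ a ∈ S, ∃ b ∈ T, a ≠ v ∧ b ≠ v ∧ G.Adj a b := by
  obtain ⟨q₁, c₁, hc₁, ho₁, rfl⟩ := hS
  obtain ⟨q₂, c₂, hc₂, ho₂, rfl⟩ := hT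
  obtain ⟨a, b, ha, hb, hab, hn₁, hn₂⟩ := h q₁ c₁ q₂ c₂ hc₁ ho₁ hc₂ ho₂ ⟨v, hST⟩
  have hv : v ∈ cycVerts q₁ c₁ ∩ cycVerts q₂ c₂ := by rw [hST]; rfl
  refine ⟨a, ha, b, hb, ?_, ?_, hab⟩
  · rintro rfl
    exact hn₂ (mem_cycEdges_of_isMinimalCycle hc₂ hv.2 hb hab)
  · rintro rfl
    exact hn₁ (mem_cycEdges_of_isMinimalCycle hc₁ ha hv.1 hab)

theorem IsOddHole.exists_adj_of_disjoint (h : CondOddCyclesDisjoint G) {S T : Set V}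
    (hS : IsOddHole G S) (hT : IsOddHole G T) (hST : ∀ v ∈ S, v ∉ T) :
    ∃ a ∈ S, ∃ b ∈ T, ∃ a' ∈ S, ∃ b' ∈ T, G.Adj a b ∧ G.Adj a' b' ∧ (a ≠ a' ∨ b ≠ b') := by
  obtain ⟨q₁, c₁, hc₁, ho₁, rfl⟩ := hS
  obtain ⟨q₂, c₂, hc₂, ho₂, rfl⟩ := hT
  obtain ⟨e₁, e₂, hne, ⟨h₁, a, b, ha, hb, rfl⟩, ⟨h₂, a', b', ha', hb', rfl⟩⟩ :=
    h q₁ c₁ q₂ c₂ hc₁ ho₁ hc₂ ho₂ (Set.eq_empty_iff_forall_notMem.2 fun v hv => hST v hv.1 hv.2)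
  refine ⟨a, ha, b, hb, a', ha', b', hb', h₁, h₂, ?_⟩
  by_contra! hcon
  exact hne (by rw [hcon.1, hcon.2])

theorem isOddHole_image (g : ℕ → V) {q : ℕ} (hq : 3 ≤ q) (hodd : Odd q)
    (hadj : ∀ k, k + 1 < q → G.Adj (g k) (g (k + 1))) (hclose : G.Adj (g (q - 1)) (g 0))
    (hinj : ∀ i j, i < j → j < q → g i ≠ g j)
    (hchord : ∀ i j, i < j → j < q → G.Adj (g i) (g j) → j = i + 1 ∨ (i = 0 ∧ j = q - 1)) :
    IsOddHole G (g '' {k | k < q}) := by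
  have : NeZero q := ⟨by omega⟩
  have : Fact (1 < q) := ⟨by omega⟩
  have hsucc : ∀ i : ZMod q, (i + 1).val = (i.val + 1) % q := fun i => by
    rw [ZMod.val_add, ZMod.val_one]
  have hcase : ∀ i : ZMod q, (i.val + 1 < q ∧ (i + 1).val = i.val + 1) ∨
      (i.val = q - 1 ∧ (i + 1).val = 0) := by
    intro i
    have hlt := i.val_lt
    rcases Nat.lt_or_ge (i.val + 1) q with h | h
    · exact Or.inl ⟨h, by rw [hsucc, Nat.mod_eq_of_lt h]⟩
    · refine Or.inr ⟨by omega, ?_⟩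
      rw [hsucc, show i.val + 1 = q by omega, Nat.mod_self]
  have hne : ∀ i j : ZMod q, i.val < j.val → s(g i.val, g j.val) ∈ G.edgeSet →
      s(g i.val, g j.val) ∈ cycEdges q (fun k => g k.val) := by
    intro i j hij hadj'
    rcases hchord _ _ hij j.val_lt hadj' with h | ⟨h, h'⟩
    · refine ⟨i, ?_⟩
      rcases hcase i with h1 | h1
      · simp only [h1.2, h]
      · have := j.val_lt
        omega
    · refine ⟨j, ?_⟩
      rcases hcase j with h1 | h1
      · omega
      · simp only [h1.2, h]
        exact Sym2.eq_swap
  refine ⟨q, fun k => g k.val, ⟨⟨hq, ?_, ?_⟩, ?_⟩, hodd, ?_⟩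
  · intro i j hij
    apply ZMod.val_injective q
    rcases Nat.lt_trichotomy i.val j.val with h | h | h
    · exact absurd hij (hinj _ _ h j.val_lt)
    · exact h
    · exact absurd hij.symm (hinj _ _ h i.val_lt)
  · intro i
    rcases hcase i with ⟨h1, h2⟩ | ⟨h1, h2⟩
    · simp only [h2]; exact hadj _ h1
    · simp only [h1, h2]; exact hclose
  · rintro e ⟨he, hnot, i, j, rfl⟩
    rcases Nat.lt_trichotomy i.val j.val with h | h | h
    · exact hnot (hne i j h he)
    · simp only [h] at he
      exact G.loopless.irrefl _ he
    · simp only [Sym2.eq_swap (a := g i.val)] at he hnot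
      exact hnot (hne j i h he)
  · ext v
    constructor
    · rintro ⟨i, rfl⟩
      exact ⟨i.val, i.val_lt, rfl⟩
    · rintro ⟨k, hk, rfl⟩
      exact ⟨(k : ZMod q), by simp only [ZMod.val_natCast, Nat.mod_eq_of_lt hk]⟩

/-- The segment `s, …, t` of `w` closes up to an odd cycle, either because `w s = w t` or by
means of an edge between `w s` and `w t`. -/
def IsOddArc (G : SimpleGraph V) (w : ℕ → V) (s t : ℕ) : Prop :=
  s < t ∧ ((w s = w t ∧ Odd (t - s)) ∨ (G.Adj (w s) (w t) ∧ Even (t - s)))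

/-- An odd arc that contains no smaller one. -/
def IsMinOddArc (G : SimpleGraph V) (w : ℕ → V) (s t : ℕ) : Prop :=
  IsOddArc G w s t ∧ ∀ s' t', s ≤ s' → t' ≤ t → IsOddArc G w s' t' → s' = s ∧ t' = t

theorem IsOddArc.exists_isMinOddArc {w : ℕ → V} {s t : ℕ} (h : IsOddArc G w s t) :
    ∃ s' t', s ≤ s' ∧ t' ≤ t ∧ IsMinOddArc G w s' t' := by
  induction hd : t - s using Nat.strong_induction_on generalizing s t with
  | _ d ih =>
    by_cases hmin : IsMinOddArc G w s t
    · exact ⟨s, t, le_rfl, le_rfl, hmin⟩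
    · simp only [IsMinOddArc, not_and, not_forall] at hmin
      obtain ⟨s', t', hs, ht, harc, hne⟩ := hmin h
      have := harc.1
      have := h.1
      obtain ⟨s'', t'', h1, h2, h3⟩ := ih (t' - s') (by
        by_contra hcon
        exact hne (by omega) (by omega)) harc rfl
      exact ⟨s'', t'', hs.trans h1, h2.trans ht, h3⟩

variable {n : ℕ} {w : ℕ → V}

theorem IsMinOddArc.isOddHole (hw : IsRigid G n w) {s t : ℕ} (h : IsMinOddArc G w s t)
    (hst : t - s < 2 * n) : IsOddHole G (w '' Set.Icc s t) := by
  obtain ⟨⟨hlt, harc⟩, hmin⟩ := h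
  have main : ∀ q, 3 ≤ q → Odd q → s + q ≤ t + 1 → q < 2 * n → G.Adj (w (s + (q - 1))) (w s) →
      ((w s = w t ∧ Odd (t - s) ∧ q = t - s) ∨ (Even (t - s) ∧ q = t - s + 1)) →
      IsOddHole G (w '' Set.Icc s t) := by
    intro q hq hodd hqt hqn hclose hcase
    have := isOddHole_image (G := G) (fun k => w (s + k)) hq hodd (fun k _ => hw.adj _) hclose
      (by
        intro i j hij hjq heq
        rcases Nat.even_or_odd (j - i) with hpar | hpar
        · have := hw.ne (s + i) (j - i) hpar (by omega) (by omega)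
          rw [show s + i + (j - i) = s + j by omega] at this
          exact this heq
        · have := hmin (s + i) (s + j) (by omega) (by omega)
            ⟨by omega, Or.inl ⟨heq, by rwa [show s + j - (s + i) = j - i by omega]⟩⟩
          rcases hcase with ⟨-, h2, h3⟩ | ⟨h2, h3⟩
          · omega
          · rw [show t - s = j - i by omega] at h2
            exact absurd h2 (Nat.not_even_iff_odd.2 hpar))
      (by
        intro i j hij hjq hadj
        rcases Nat.even_or_odd (j - i) with hpar | hpar
        · have := hmin (s + i) (s + j) (by omega) (by omega)
            ⟨by omega, Or.inr ⟨hadj, by rwa [show s + j - (s + i) = j - i by omega]⟩⟩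
          omega
        · by_contra hcon
          have := hw.not_adj (s + i) (j - i) hpar (by obtain ⟨c, hc⟩ := hpar; omega)
            (by obtain ⟨c, hc⟩ := hpar; obtain ⟨c', hc'⟩ := hodd; omega)
          rw [show s + i + (j - i) = s + j by omega] at this
          exact this hadj)
    convert this using 1
    ext v
    constructor
    · rintro ⟨k, ⟨hk1, hk2⟩, rfl⟩
      by_cases hk : k - s < q
      · exact ⟨k - s, hk, by simp only; congr 1; omega⟩
      · rcases hcase with ⟨h1, h2, h3⟩ | ⟨h2, h3⟩
        · have : k = t := by omega
          subst this
          exact ⟨0, by simp only [Set.mem_ofPred_eq]; omega, by simpa using h1⟩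
        · omega
    · rintro ⟨k, hk, rfl⟩
      simp only [Set.mem_ofPred_eq] at hk
      exact ⟨s + k, ⟨by omega, by omega⟩, rfl⟩
  rcases harc with ⟨heq, hodd⟩ | ⟨hadj, heven⟩
  · have hne1 : t - s ≠ 1 := by
      intro h1
      have := hw.adj s
      rw [show s + 1 = t by omega, heq] at this
      exact G.loopless.irrefl _ this
    refine main (t - s) (by obtain ⟨c, hc⟩ := hodd; omega) hodd (by omega) hst ?_
      (Or.inl ⟨heq, hodd, rfl⟩)
    have := hw.adj (t - 1)
    rw [show t - 1 + 1 = t by omega, ← heq] at this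
    rwa [show s + (t - s - 1) = t - 1 by omega]
  · obtain ⟨c, hc⟩ := heven
    refine main (t - s + 1) (by omega) ⟨c, by omega⟩ (by omega) (by omega) ?_
      (Or.inr ⟨⟨c, hc⟩, rfl⟩)
    rw [show s + (t - s + 1 - 1) = t by omega]
    exact hadj.symm

end OddHole

/-! ### Rigid walks do not exist -/

section Rigid

variable {V : Type*} {G : SimpleGraph V} {n : ℕ} {w : ℕ → V}

theorem IsRigid.shift (hw : IsRigid G n w) (r : ℕ) : IsRigid G n (fun k => w (r + k)) := by
  refine ⟨fun k => hw.adj _, fun k => ?_, fun i d h1 h2 h3 => ?_, fun i d h1 h2 h3 => ?_,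
    fun i t h1 h2 h3 h4 h5 p q h6 h7 h8 h9 => ?_⟩
  · rw [← add_assoc]; exact hw.per _
  · rw [← add_assoc]; exact hw.not_adj _ d h1 h2 h3
  · rw [← add_assoc]; exact hw.ne _ d h1 h2 h3
  · simp only [← add_assoc] at h4 h5 ⊢
    exact hw.cross (r + i) t h1 h2 h3 h4 h5 p q h6 h7 h8 h9

theorem IsRigid.eq_of_adj_of_isMinOddArc (hw : IsRigid G n w) {i j s t p p' : ℕ}
    (hij : j - i < 2 * n) (hodd : Odd (j - i)) (heq : w i = w j) (hmin : IsMinOddArc G w s t)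
    (his : i < s) (htj : t < j) (hp : p ∈ Set.Icc s t) (hp' : p' ∈ Set.Icc s t)
    (hadj : G.Adj (w i) (w p)) (hadj' : G.Adj (w i) (w p')) : w p = w p' := by
  have key : ∀ p ∈ Set.Icc s t, G.Adj (w i) (w p) → p = i + 1 ∨ p + 1 = j := by
    rintro p ⟨h1, h2⟩ hadj
    obtain ⟨c, hc⟩ := hodd
    rcases Nat.even_or_odd (p - i) with ⟨b, hb⟩ | ⟨b, hb⟩
    · by_contra hcon
      have := hw.not_adj p (j - p) ⟨c - b, by omega⟩ (by omega) (by omega)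
      rw [show p + (j - p) = j by omega, ← heq] at this
      exact this hadj.symm
    · by_contra hcon
      have := hw.not_adj i (p - i) ⟨b, hb⟩ (by omega) (by omega)
      rw [show i + (p - i) = p by omega] at this
      exact this hadj
  obtain ⟨⟨hst, h⟩, -⟩ := hmin
  obtain ⟨c, hc⟩ := hodd
  have hends : ∀ p p', p ∈ Set.Icc s t → p' ∈ Set.Icc s t → p = i + 1 → p' + 1 = j →
      w p = w p' := by
    rintro p p' ⟨h1, h2⟩ ⟨h3, h4⟩ h5 h6
    have e1 : p = s := by omega
    have e2 : p' = t := by omega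
    subst e1 e2
    rcases h with h | ⟨-, b, hb⟩
    · exact h.1
    · omega
  rcases key p hp hadj with h1 | h1 <;> rcases key p' hp' hadj' with h2 | h2
  · rw [h1, h2]
  · exact hends _ _ hp hp' h1 h2
  · exact (hends _ _ hp' hp h2 h1).symm
  · congr 1; omega

theorem IsRigid.apply_one_ne (hw : IsRigid G n w) (hm : CondOddCyclesMeet G)
    (hd : CondOddCyclesDisjoint G) {t : ℕ} (ht : Even t) (ht2 : 2 ≤ t) (htn : t + 2 ≤ 2 * n) :
    w 1 ≠ w t := by
  intro heq
  have hw2 : w (2 * n + 1) = w 1 := by rw [← hw.per 1, add_comm]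
  have ho1 : Odd (t - 1) := by obtain ⟨c, hc⟩ := ht; exact ⟨c - 1, by omega⟩
  have ho2 : Odd (2 * n + 1 - t) := by obtain ⟨c, hc⟩ := ht; exact ⟨n - c, by omega⟩
  obtain ⟨s, s', hs, hs', hP⟩ :=
    IsOddArc.exists_isMinOddArc (G := G) (w := w) ⟨(by omega : 1 < t), Or.inl ⟨heq, ho1⟩⟩
  obtain ⟨r, r', hr, hr', hQ⟩ :=
    IsOddArc.exists_isMinOddArc (G := G) (w := w)
      ⟨(by omega : t < 2 * n + 1), Or.inl ⟨by rw [hw2, heq], ho2⟩⟩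
  have hss := hP.1.1
  have hrr := hQ.1.1
  have hPh := hP.isOddHole hw (by omega)
  have hQh := hQ.isOddHole hw (by omega)
  have hcross := hw.cross 0 t ht ht2 htn
    (by have := hw.adj 0; rw [zero_add]; rwa [zero_add, heq] at this)
    (by have := hw.adj t; rw [zero_add, zero_add]; rwa [← heq] at this)
  simp only [zero_add] at hcross
  have hinter : ∀ v, v ∈ w '' Set.Icc s s' → v ∈ w '' Set.Icc r r' → v = w 1 := by
    rintro v ⟨p, ⟨h1, h2⟩, rfl⟩ ⟨q, ⟨h3, h4⟩, hpq⟩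
    rcases Nat.lt_or_ge t q with h5 | h5
    · rcases Nat.lt_or_ge (2 * n) q with h6 | h6
      · rw [← hpq, ← hw2]; congr 1; omega
      · exact absurd hpq.symm (hcross p q (by omega) (by omega) h5 h6).1
    · rw [← hpq, heq]; congr 1; omega
  have hedge : ∀ a ∈ w '' Set.Icc s s', ∀ b ∈ w '' Set.Icc r r', G.Adj a b →
      a = w 1 ∨ b = w 1 := by
    rintro _ ⟨p, ⟨h1, h2⟩, rfl⟩ _ ⟨q, ⟨h3, h4⟩, rfl⟩ hadj
    rcases Nat.lt_or_ge t q with h5 | h5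
    · rcases Nat.lt_or_ge (2 * n) q with h6 | h6
      · right; rw [← hw2]; congr 1; omega
      · left
        rcases ((hcross p q (by omega) (by omega) h5 h6).2 hadj).1 with rfl | rfl
        · exact heq.symm
        · rfl
    · right; rw [heq]; congr 1; omega
  by_cases hvP : w 1 ∈ w '' Set.Icc s s'
  · by_cases hvQ : w 1 ∈ w '' Set.Icc r r'
    · obtain ⟨a, ha, b, hb, h1, h2, hab⟩ := hPh.exists_adj_of_inter_eq hm hQh
        (v := w 1) (by
          ext v
          simp only [Set.mem_inter_iff, Set.mem_singleton_iff]
          exact ⟨fun h => hinter v h.1 h.2, fun h => h ▸ ⟨hvP, hvQ⟩⟩)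
      rcases hedge a ha b hb hab with h | h
      · exact h1 h
      · exact h2 h
    · obtain ⟨a, ha, b, hb, a', ha', b', hb', h1, h2, h3⟩ := hPh.exists_adj_of_disjoint hd hQh
        (fun v hv hv' => hvQ (hinter v hv hv' ▸ hv'))
      have hrt : t < r := by
        by_contra hcon
        exact hvQ ⟨r, ⟨le_rfl, hrr.le⟩, by rw [heq]; congr 1; omega⟩
      have hrt' : r' < 2 * n + 1 := by
        by_contra hcon
        exact hvQ ⟨r', ⟨hrr.le, le_rfl⟩, by rw [← hw2]; congr 1; omega⟩
      have e1 : a = w t := (hedge a ha b hb h1).elim (fun h => h.trans heq)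
        fun h => absurd (h ▸ hb) hvQ
      have e2 : a' = w t := (hedge a' ha' b' hb' h2).elim (fun h => h.trans heq)
        fun h => absurd (h ▸ hb') hvQ
      subst e1 e2
      obtain ⟨q, hq, rfl⟩ := hb
      obtain ⟨q', hq', rfl⟩ := hb'
      refine h3.elim (fun h => h rfl) fun h => h ?_
      exact hw.eq_of_adj_of_isMinOddArc (by omega) ho2 (by rw [hw2, heq]) hQ hrt hrt' hq hq' h1 h2
  · obtain ⟨a, ha, b, hb, a', ha', b', hb', h1, h2, h3⟩ := hPh.exists_adj_of_disjoint hd hQh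
      (fun v hv hv' => hvP (hinter v hv hv' ▸ hv))
    have hst : 1 < s := by
      by_contra hcon
      exact hvP ⟨s, ⟨le_rfl, hss.le⟩, by congr 1; omega⟩
    have hst' : s' < t := by
      by_contra hcon
      exact hvP ⟨s', ⟨hss.le, le_rfl⟩, by rw [heq]; congr 1; omega⟩
    have e1 : b = w 1 := (hedge a ha b hb h1).elim (fun h => absurd (h ▸ ha) hvP) id
    have e2 : b' = w 1 := (hedge a' ha' b' hb' h2).elim (fun h => absurd (h ▸ ha') hvP) id
    subst e1 e2
    obtain ⟨q, hq, rfl⟩ := ha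
    obtain ⟨q', hq', rfl⟩ := ha'
    refine h3.elim (fun h => h ?_) fun h => h rfl
    exact hw.eq_of_adj_of_isMinOddArc (by omega) ho1 heq hP hst hst' hq hq' h1.symm h2.symm

theorem IsRigid.apply_ne (hw : IsRigid G n w) (hm : CondOddCyclesMeet G)
    (hd : CondOddCyclesDisjoint G) (i d : ℕ) (hd0 : 0 < d) (hdn : d < 2 * n) :
    w i ≠ w (i + d) := by
  rcases Nat.even_or_odd d with hpar | hpar
  · exact hw.ne i d hpar hd0 hdn
  intro heq
  rcases Nat.lt_or_ge d (2 * n - 1) with h | h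
  · have := (hw.shift (i + (2 * n - 1))).apply_one_ne hm hd (t := d + 1) hpar.add_one (by omega)
      (by obtain ⟨c, hc⟩ := hpar; omega)
    apply this
    rw [show i + (2 * n - 1) + 1 = i + 2 * n by omega,
      show i + (2 * n - 1) + (d + 1) = i + d + 2 * n by omega, hw.per, hw.per, heq]
  · have := hw.adj (i + d)
    rw [show i + d + 1 = i + 2 * n by omega, hw.per, heq] at this
    exact G.loopless.irrefl _ this

/-- Crossing odd chords `{w 0, w t}` and `{w 1, w (t + 1)}`. -/
structure IsCrossed (G : SimpleGraph V) (n t : ℕ) (w : ℕ → V) : Prop where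
  even : Even t
  two_le : 2 ≤ t
  le : t + 2 ≤ 2 * n
  adj_zero : G.Adj (w 0) (w t)
  adj_one : G.Adj (w 1) (w (t + 1))

variable {t : ℕ}

theorem IsRigid.cross' (hw : IsRigid G n w) (hc : IsCrossed G n t w) {p q : ℕ} (hp : 1 ≤ p)
    (hpt : p ≤ t) (hqt : t + 1 ≤ q) (hqn : q ≤ 2 * n) :
    w p ≠ w q ∧ (G.Adj (w p) (w q) → (p = t ∨ p = 1) ∧ (q = t + 1 ∨ q = 2 * n)) := by
  have := hw.cross 0 t hc.even hc.two_le hc.le (by simpa using hc.adj_zero)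
    (by simpa using hc.adj_one) p q hp hpt hqt hqn
  simpa using this

theorem isOddArc_even (hinj : ∀ i d, 0 < d → d < 2 * n → w i ≠ w (i + d)) {s t : ℕ}
    (h : IsOddArc G w s t) (hst : t - s < 2 * n) : G.Adj (w s) (w t) ∧ Even (t - s) := by
  obtain ⟨hlt, ⟨h1, -⟩ | h1⟩ := h
  · have := hinj s (t - s) (by omega) hst
    rw [show s + (t - s) = t by omega] at this
    exact absurd h1 this
  · exact h1

/-- A minimal odd arc inside the segment `1, …, t` contains neither `1` nor `t`; both cases are
covered by a corner `z` and the arc `u, …, u'` closing up through `z` on the other side. -/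
theorem IsRigid.not_corner_of_isMinOddArc (hw : IsRigid G n w) (hm : CondOddCyclesMeet G)
    (hd : CondOddCyclesDisjoint G) (hinj : ∀ i d, 0 < d → d < 2 * n → w i ≠ w (i + d))
    (hc : IsCrossed G n t w) {s s' : ℕ} (hP : IsMinOddArc G w s s') (hs : 1 ≤ s) (hs' : s' ≤ t) :
    s ≠ 1 ∧ s' ≠ t := by
  have hss := hP.1.1
  have hle := hc.le
  have hw2 : w (2 * n + 1) = w 1 := by rw [← hw.per 1, add_comm]
  have hw0 : w (2 * n) = w 0 := by have := hw.per 0; rwa [zero_add] at this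
  obtain ⟨hadjP, b, hb⟩ := isOddArc_even hinj hP.1 (by omega)
  obtain ⟨c, hc'⟩ := hc.even
  have hPh := hP.isOddHole hw (by omega)
  have main : ∀ z r r', (z = s ∨ z = s') → (z = 1 ∨ z = t) → (∀ p, s ≤ p → p ≤ s' →
      (p = t ∨ p = 1) → p = z) → IsMinOddArc G w r r' → r' - r < 2 * n →
      (∀ q, r ≤ q → q ≤ r' → (t + 1 ≤ q ∧ q ≤ 2 * n) ∨ w q = w z) → False := by
    intro z r r' hz hz' hpz hQ hrn hQz
    have hQh := hQ.isOddHole hw hrn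
    have hinter : ∀ v, v ∈ w '' Set.Icc s s' → v ∈ w '' Set.Icc r r' → v = w z := by
      rintro v ⟨p, ⟨h1, h2⟩, rfl⟩ ⟨q, ⟨h3, h4⟩, hpq⟩
      rcases hQz q h3 h4 with ⟨h5, h6⟩ | h5
      · exact absurd hpq.symm (hw.cross' hc (by omega) (by omega) h5 h6).1
      · rw [← hpq, h5]
    have hedge : ∀ p ∈ Set.Icc s s', ∀ q ∈ Set.Icc r r', G.Adj (w p) (w q) → w q ≠ w z →
        p = z ∧ (q = t + 1 ∨ q = 2 * n) := by
      rintro p ⟨h1, h2⟩ q ⟨h3, h4⟩ hadj hne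
      rcases hQz q h3 h4 with ⟨h5, h6⟩ | h5
      · have := (hw.cross' hc (by omega) (by omega) h5 h6).2 hadj
        exact ⟨hpz p h1 h2 this.1, this.2⟩
      · exact absurd h5 hne
    have hzP : w z ∈ w '' Set.Icc s s' := ⟨z, ⟨by omega, by omega⟩, rfl⟩
    by_cases hzQ : w z ∈ w '' Set.Icc r r'
    · obtain ⟨a, ⟨p, hp, rfl⟩, b, ⟨q, hq, rfl⟩, h1, h2, hab⟩ :=
        hPh.exists_adj_of_inter_eq hm hQh (v := w z) (by
          ext v
          simp only [Set.mem_inter_iff, Set.mem_singleton_iff]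
          exact ⟨fun h => hinter v h.1 h.2, fun h => h ▸ ⟨hzP, hzQ⟩⟩)
      exact h1 (by rw [(hedge p hp q hq hab h2).1])
    · obtain ⟨_, ⟨p, hp, rfl⟩, _, ⟨q, hq, rfl⟩, _, ⟨p', hp', rfl⟩, _, ⟨q', hq', rfl⟩, h1, h2, h3⟩ :=
        hPh.exists_adj_of_disjoint hd hQh (fun v hv hv' => hzQ (hinter v hv hv' ▸ hv'))
      obtain ⟨rfl, h4⟩ := hedge p hp q hq h1 fun h => hzQ ⟨q, hq, h⟩
      obtain ⟨rfl, h5⟩ := hedge p' hp' q' hq' h2 fun h => hzQ ⟨q', hq', h⟩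
      have hqq : q ≠ q' := by
        rintro rfl
        exact h3.elim (fun h => h rfl) fun h => h rfl
      obtain ⟨-, b', hb'⟩ := isOddArc_even hinj hQ.1 hrn
      have hr1 : ∀ q, r ≤ q → q ≤ r' → t + 1 ≤ q ∧ q ≤ 2 * n := fun q h6 h7 =>
        (hQz q h6 h7).resolve_right fun h => hzQ ⟨q, ⟨h6, h7⟩, h⟩
      have := hQ.1.1
      have := hr1 r le_rfl (by omega)
      have := hr1 r' (by omega) le_rfl
      obtain ⟨h6, h7⟩ := hq
      obtain ⟨h8, h9⟩ := hq'
      omega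
  constructor
  · rintro rfl
    obtain ⟨r, r', hr, hr', hQ⟩ :=
      IsOddArc.exists_isMinOddArc (G := G) (w := w) (s := t + 1) (t := 2 * n + 1)
        ⟨by omega, Or.inr ⟨by rw [hw2]; exact hc.adj_one.symm, ⟨n - c, by omega⟩⟩⟩
    refine main 1 r r' (Or.inl rfl) (Or.inl rfl) (fun p _ _ _ => by omega) hQ (by omega) ?_
    intro q h1 h2
    rcases Nat.lt_or_ge (2 * n) q with h3 | h3
    · right; rw [← hw2]; congr 1; omega
    · left; omega
  · rintro rfl
    obtain ⟨r, r', hr, hr', hQ⟩ :=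
      IsOddArc.exists_isMinOddArc (G := G) (w := w) (s := s') (t := 2 * n)
        ⟨by omega, Or.inr ⟨by rw [hw0]; exact hc.adj_zero.symm, ⟨n - c, by omega⟩⟩⟩
    refine main s' r r' (Or.inr rfl) (Or.inr rfl) (fun p _ _ _ => by omega) hQ (by omega) ?_
    intro q h1 h2
    rcases Nat.lt_or_ge s' q with h3 | h3
    · left; omega
    · right; congr 1; omega

theorem IsRigid.exists_adj_of_isMinOddArc (hw : IsRigid G n w) (hm : CondOddCyclesMeet G)
    (hd : CondOddCyclesDisjoint G) (hinj : ∀ i d, 0 < d → d < 2 * n → w i ≠ w (i + d))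
    (hc : IsCrossed G n t w) {s s' : ℕ} (hP : IsMinOddArc G w s s') (hs : 1 ≤ s) (hs' : s' ≤ t) :
    ∃ p p', s ≤ p ∧ p < p' ∧ p' ≤ s' ∧ G.Adj (w p) (w t) ∧ G.Adj (w p') (w t) := by
  have hss := hP.1.1
  have hle := hc.le
  have hw0 : w (2 * n) = w 0 := by have := hw.per 0; rwa [zero_add] at this
  obtain ⟨c, hc'⟩ := hc.even
  obtain ⟨hs1, hst⟩ := hw.not_corner_of_isMinOddArc hm hd hinj hc hP hs hs'
  obtain ⟨r, r', hr, hr', hQ⟩ :=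
    IsOddArc.exists_isMinOddArc (G := G) (w := w) (s := t) (t := 2 * n)
      ⟨by omega, Or.inr ⟨by rw [hw0]; exact hc.adj_zero.symm, ⟨n - c, by omega⟩⟩⟩
  have hedge : ∀ p ∈ Set.Icc s s', ∀ q ∈ Set.Icc r r', G.Adj (w p) (w q) → q = t := by
    rintro p ⟨h1, h2⟩ q ⟨h3, h4⟩ hadj
    by_contra hcon
    have := (hw.cross' hc (p := p) (q := q) (by omega) (by omega) (by omega) (by omega)).2 hadj
    omega
  obtain ⟨_, ⟨p, hp, rfl⟩, _, ⟨q, hq, rfl⟩, _, ⟨p', hp', rfl⟩, _, ⟨q', hq', rfl⟩, h1, h2, h3⟩ :=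
    (hP.isOddHole hw (by omega)).exists_adj_of_disjoint hd (hQ.isOddHole hw (by omega)) (by
      rintro _ ⟨p, ⟨h1, h2⟩, rfl⟩ ⟨q, ⟨h3, h4⟩, heq⟩
      have := hinj p (q - p) (by omega) (by omega)
      rw [show p + (q - p) = q by omega] at this
      exact this heq.symm)
  obtain rfl := hedge p hp q hq h1
  obtain rfl := hedge p' hp' q' hq' h2
  have hne : p ≠ p' := by
    rintro rfl
    exact h3.elim (fun h => h rfl) fun h => h rfl
  rcases Nat.lt_or_gt_of_ne hne with h | h
  · exact ⟨p, p', hp.1, h, hp'.2, h1, h2⟩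
  · exact ⟨p', p, hp'.1, h, hp.2, h2, h1⟩

theorem IsRigid.not_isOddArc (hw : IsRigid G n w) (hm : CondOddCyclesMeet G)
    (hd : CondOddCyclesDisjoint G) (hinj : ∀ i d, 0 < d → d < 2 * n → w i ≠ w (i + d))
    (hc : IsCrossed G n t w) {s s' : ℕ} (hs : 1 ≤ s) (hs' : s' ≤ t) : ¬ IsOddArc G w s s' := by
  have hle := hc.le
  have hpar : ∀ p, 1 ≤ p → p < t → G.Adj (w p) (w t) → Even (t - p) ∨ p + 1 = t := by
    intro p h1 h2 h3
    refine (Nat.even_or_odd (t - p)).imp_right fun h => ?_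
    by_contra hcon
    have := hw.not_adj p (t - p) h (by obtain ⟨c, hc⟩ := h; omega) (by omega)
    rw [show p + (t - p) = t by omega] at this
    exact this h3
  have hend : ∀ u, 1 ≤ u → ¬ IsOddArc G w u t := by
    intro u hu harc
    induction hk : t - u using Nat.strong_induction_on generalizing u with
    | _ k ih =>
      obtain ⟨r, r', hr, hr', hP⟩ := harc.exists_isMinOddArc
      obtain ⟨h1, h2⟩ := hw.not_corner_of_isMinOddArc hm hd hinj hc hP (by omega) hr'
      obtain ⟨p, p', h3, h4, h5, h6, h7⟩ :=
        hw.exists_adj_of_isMinOddArc hm hd hinj hc hP (by omega) hr'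
      have e1 : Even (t - p) := (hpar p (by omega) (by omega) h6).resolve_right (by omega)
      have hup : u = p := by
        by_contra hcon
        exact ih (t - p) (by omega) p (by omega) ⟨by omega, Or.inr ⟨h6, e1⟩⟩ rfl
      rcases hpar p' (by omega) (by omega) h7 with e2 | e2
      · exact ih (t - p') (by omega) p' (by omega) ⟨by omega, Or.inr ⟨h7, e2⟩⟩ rfl
      · obtain ⟨-, b, hb⟩ := isOddArc_even hinj hP.1 (by omega)
        obtain ⟨b', hb'⟩ := e1
        omega
  intro harc
  obtain ⟨r, r', hr, hr', hP⟩ := harc.exists_isMinOddArc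
  obtain ⟨h1, h2⟩ := hw.not_corner_of_isMinOddArc hm hd hinj hc hP (by omega) (by omega)
  obtain ⟨p, p', h3, h4, h5, h6, h7⟩ :=
    hw.exists_adj_of_isMinOddArc hm hd hinj hc hP (by omega) (by omega)
  exact hend p (by omega) ⟨by omega, Or.inr ⟨h6,
    (hpar p (by omega) (by omega) h6).resolve_right (by omega)⟩⟩

/-- The closed walk `w` has an edge joining vertices of opposite parity which are not neighbours
on `w`. -/
def HasEvenChord (G : SimpleGraph V) (n : ℕ) (w : ℕ → V) : Prop :=
  ∃ i d, Odd d ∧ 3 ≤ d ∧ d + 3 ≤ 2 * n ∧ G.Adj (w i) (w (i + d))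

/-- The closed walk `w` has two crossing odd chords and a third odd chord. -/
def HasCrossing (G : SimpleGraph V) (n : ℕ) (w : ℕ → V) : Prop :=
  ∃ r t, Even t ∧ 2 ≤ t ∧ t + 2 ≤ 2 * n ∧ G.Adj (w r) (w (r + t)) ∧
    G.Adj (w (r + 1)) (w (r + t + 1)) ∧ ∃ p d, Even d ∧ 0 < d ∧ d < 2 * n ∧
      G.Adj (w p) (w (p + d)) ∧ s(w p, w (p + d)) ≠ s(w r, w (r + t)) ∧
      s(w p, w (p + d)) ≠ s(w (r + 1), w (r + t + 1))

theorem exists_mem_period_apply_eq (hw : ∀ k, w (k + 2 * n) = w k) (hn : 0 < n) (r p : ℕ) :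
    ∃ p', 1 ≤ p' ∧ p' ≤ 2 * n ∧ w (r + p') = w p ∧ (r + p') % 2 = p % 2 := by
  have hmod : ∀ k, w (k % (2 * n)) = w k := by
    intro k
    have hk : ∀ c a, w (a + 2 * n * c) = w a := by
      intro c
      induction c with
      | zero => intro a; rfl
      | succ c ih => intro a; rw [Nat.mul_succ, ← add_assoc, hw, ih]
    conv_rhs => rw [← Nat.mod_add_div k (2 * n)]
    rw [hk]
  have hlt := Nat.mod_lt (p + (2 * n - r % (2 * n)) + 2 * n - 1) (show 2 * n > 0 by omega)
  have hr := Nat.mod_lt r (show 2 * n > 0 by omega)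
  refine ⟨(p + (2 * n - r % (2 * n)) + 2 * n - 1) % (2 * n) + 1, by omega, by omega, ?_, ?_⟩
  · rw [← hmod, ← hmod p]
    congr 1
    have : r + ((p + (2 * n - r % (2 * n)) + 2 * n - 1) % (2 * n) + 1) ≡ p [MOD 2 * n] := by
      have h1 : (p + (2 * n - r % (2 * n)) + 2 * n - 1) % (2 * n) ≡
          p + (2 * n - r % (2 * n)) + 2 * n - 1 [MOD 2 * n] := Nat.mod_modEq _ _
      have h2 : r % (2 * n) ≡ r [MOD 2 * n] := Nat.mod_modEq _ _
      have h3 := (h2.symm.add (h1.add_right 1))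
      refine h3.trans ?_
      rw [show r % (2 * n) + (p + (2 * n - r % (2 * n)) + 2 * n - 1 + 1) =
        p + 2 * n + 2 * n by omega]
      unfold Nat.ModEq
      simp
    exact this
  · have h1 := Nat.mod_mul_right_mod (p + (2 * n - r % (2 * n)) + 2 * n - 1) 2 n
    have h2 := Nat.mod_mul_right_mod r 2 n
    omega

theorem IsRigid.not_hasCrossing (hw : IsRigid G n w) (hm : CondOddCyclesMeet G)
    (hd : CondOddCyclesDisjoint G) (hinj : ∀ i d, 0 < d → d < 2 * n → w i ≠ w (i + d)) :
    ¬ HasCrossing G n w := by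
  rintro ⟨r, t, ht, ht2, htn, h1, h2, p, d, hde, hd0, hdn, hadj, hne1, hne2⟩
  have hinj' : ∀ r i d, 0 < d → d < 2 * n → w (r + i) ≠ w (r + (i + d)) := fun r i d h h' => by
    rw [← add_assoc]; exact hinj _ _ h h'
  obtain ⟨p', hp1, hp2, hp3, hp4⟩ := exists_mem_period_apply_eq hw.per (by omega) r p
  obtain ⟨q', hq1, hq2, hq3, hq4⟩ := exists_mem_period_apply_eq hw.per (by omega) r (p + d)
  rw [← hp3, ← hq3] at hadj hne1 hne2
  have hpar : p' % 2 = q' % 2 := by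
    obtain ⟨c, hc⟩ := hde
    omega
  clear hp3 hq3 hp4 hq4 hd0 hdn hde
  have hw0 : w (r + 2 * n) = w r := hw.per r
  have hc : IsCrossed G n t (fun k => w (r + k)) := ⟨ht, ht2, htn, h1, h2⟩
  have hc' : IsCrossed G n (2 * n - t) (fun k => w (r + t + k)) := by
    obtain ⟨c, hc⟩ := ht
    refine ⟨⟨n - c, by omega⟩, by omega, by omega, ?_, ?_⟩
    · show G.Adj (w (r + t)) (w (r + t + (2 * n - t)))
      rw [show r + t + (2 * n - t) = r + 2 * n by omega, hw0]
      exact h1.symm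
    · show G.Adj (w (r + t + 1)) (w (r + t + (2 * n - t + 1)))
      rw [show r + t + (2 * n - t + 1) = r + 1 + 2 * n by omega, hw.per]
      exact h2.symm
  have main : ∀ p q, 1 ≤ p → p ≤ 2 * n → 1 ≤ q → q ≤ 2 * n → p % 2 = q % 2 → p < q →
      G.Adj (w (r + p)) (w (r + q)) → s(w (r + p), w (r + q)) ≠ s(w r, w (r + t)) →
      s(w (r + p), w (r + q)) ≠ s(w (r + 1), w (r + t + 1)) → False := by
    intro p q hp1 hp2 hq1 hq2 hpar hlt hadj hne1 hne2
    have heven : Even (q - p) := ⟨(q - p) / 2, by omega⟩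
    rcases Nat.lt_or_ge t q with h3 | h3
    · rcases Nat.lt_or_ge t p with h4 | h4
      · refine (hw.shift (r + t)).not_isOddArc hm hd (hinj' _) hc' (s := p - t) (s' := q - t)
          (by omega) (by omega) ⟨by omega, Or.inr ⟨?_, by rwa [Nat.sub_sub_sub_cancel_right h4.le]⟩⟩
        show G.Adj (w (r + t + (p - t))) (w (r + t + (q - t)))
        rwa [show r + t + (p - t) = r + p by omega, show r + t + (q - t) = r + q by omega]
      · have := ((hw.shift r).cross' hc hp1 h4 h3 hq2).2 hadj
        obtain ⟨c, hc⟩ := ht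
        rcases this with ⟨rfl | rfl, rfl | rfl⟩
        · omega
        · rw [hw0] at hne1
          exact hne1 Sym2.eq_swap
        · exact hne2 rfl
        · omega
    · exact (hw.shift r).not_isOddArc hm hd (hinj' _) hc hp1 h3 ⟨hlt, Or.inr ⟨hadj, heven⟩⟩
  rcases Nat.lt_trichotomy p' q' with h | rfl | h
  · exact main p' q' hp1 hp2 hq1 hq2 hpar h hadj hne1 hne2
  · exact G.loopless.irrefl _ hadj
  · rw [Sym2.eq_swap] at hne1 hne2
    exact main q' p' hq1 hq2 hp1 hp2 hpar.symm h hadj.symm hne1 hne2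

end Rigid

/-! ### Even cycles as periodic walks -/

section EvenCycles

variable {V : Type*} {G : SimpleGraph V} {n : ℕ}

theorem mem_cycEdges_iff {q : ℕ} {c : ZMod q → V} (hc : Function.Injective c) {a b : ℕ}
    (hab : a < b) (hb : b < q) :
    s(c a, c b) ∈ cycEdges q c ↔ b = a + 1 ∨ a = 0 ∧ b + 1 = q := by
  have hcast : ∀ {x y : ℕ}, ((x : ℕ) : ZMod q) = y ↔ x % q = y % q :=
    fun {x y} => ZMod.natCast_eq_natCast_iff' x y q
  constructor
  · rintro ⟨i, hi⟩
    rcases Sym2.eq_iff.1 hi with ⟨h1, h2⟩ | ⟨h1, h2⟩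
    · left
      rw [← hc h1] at h2
      have := hcast (x := b) (y := a + 1) |>.1 (by push_cast; exact hc h2)
      rwa [Nat.mod_eq_of_lt hb, Nat.mod_eq_of_lt (by omega)] at this
    · right
      rw [← hc h2] at h1
      have := hcast (x := a) (y := b + 1) |>.1 (by push_cast; exact hc h1)
      rw [Nat.mod_eq_of_lt (by omega : a < q)] at this
      rcases Nat.lt_or_ge (b + 1) q with h | h
      · rw [Nat.mod_eq_of_lt h] at this
        omega
      · have h' : b + 1 = q := by omega
        rw [h', Nat.mod_self] at this
        exact ⟨this, h'⟩
  · rintro (rfl | ⟨rfl, rfl⟩)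
    · exact ⟨a, by push_cast; rfl⟩
    · refine ⟨b, ?_⟩
      rw [Sym2.eq_swap]
      have : ((b : ZMod (b + 1)) + 1) = ((0 : ℕ) : ZMod (b + 1)) := by
        have := ZMod.natCast_self (b + 1)
        push_cast at this ⊢
        exact this
      rw [this]

theorem isOddChordPair_iff {c : ZMod (2 * n) → V} (hc : Function.Injective c) {a b : ℕ}
    (ha : a < 2 * n) (hb : b < 2 * n) :
    IsOddChordPair G (2 * n) c a b ↔ a < b ∧ Even (b - a) ∧ G.Adj (c a) (c b) := by
  unfold IsOddChordPair
  rw [ZMod.val_natCast_of_lt ha, ZMod.val_natCast_of_lt hb]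
  refine and_congr_right fun h => and_congr_right fun h' => and_iff_left ?_
  rw [mem_cycEdges_iff hc h hb]
  obtain ⟨k, hk⟩ := h'
  omega

theorem exists_isEvenChord_iff (hn : 0 < n) {c : ZMod (2 * n) → V} (hc : Function.Injective c) :
    (∃ e, IsEvenChord G (2 * n) c e) ↔ HasEvenChord G n fun k => c k := by
  have : NeZero (2 * n) := ⟨by omega⟩
  have hz : ((2 * n : ℕ) : ZMod (2 * n)) = 0 := ZMod.natCast_self _
  constructor
  · rintro ⟨_, he, hcyc, i, j, hij, hodd, rfl⟩
    have hi := i.val_lt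
    have hj := j.val_lt
    rw [← ZMod.natCast_zmod_val i, ← ZMod.natCast_zmod_val j] at he hcyc
    rw [mem_cycEdges_iff hc hij hj] at hcyc
    refine ⟨i.val, j.val - i.val, hodd, ?_, ?_, ?_⟩
    · obtain ⟨k, hk⟩ := hodd; omega
    · obtain ⟨k, hk⟩ := hodd; omega
    · rwa [Nat.add_sub_cancel' hij.le]
  · rintro ⟨i, d, hodd, hd3, hdn, hadj⟩
    have key : ∀ a b, a < b → b < 2 * n → Odd (b - a) → 3 ≤ b - a → b - a + 3 ≤ 2 * n →
        G.Adj (c a) (c b) → ∃ e, IsEvenChord G (2 * n) c e := by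
      intro a b hab hb ho h1 h2 h3
      have ha' := ZMod.val_natCast_of_lt (by omega : a < 2 * n)
      have hb' := ZMod.val_natCast_of_lt hb
      refine ⟨s(c a, c b), h3, ?_, a, b, ?_, ?_, rfl⟩
      · rw [mem_cycEdges_iff hc hab hb]; omega
      · rwa [ha', hb']
      · rwa [ha', hb']
    have hlt := Nat.mod_lt i (by omega : 0 < 2 * n)
    have hi : ((i % (2 * n) : ℕ) : ZMod (2 * n)) = i := ZMod.natCast_mod i (2 * n)
    push_cast at hadj
    rw [← hi] at hadj
    generalize i % (2 * n) = a at *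
    rcases Nat.lt_or_ge (a + d) (2 * n) with h | h
    · exact key a (a + d) (by omega) h (by rwa [Nat.add_sub_cancel_left]) (by omega) (by omega)
        (by push_cast; exact hadj)
    · refine key (a + d - 2 * n) a (by omega) (by omega) ?_ (by omega) (by omega) ?_
      · obtain ⟨k, hk⟩ := hodd; exact ⟨n - k - 1, by omega⟩
      · rw [Nat.cast_sub h, hz, sub_zero]
        push_cast
        exact hadj.symm

/-- Positions of a pair of vertices at even distance on a cycle of even length, in order. -/
theorem exists_lt_of_even (c : ZMod (2 * n) → V) {p d : ℕ} (hde : Even d) (hd0 : 0 < d)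
    (hdn : d < 2 * n) (hadj : G.Adj (c p) (c (p + d : ℕ))) :
    ∃ a b, a < b ∧ b < 2 * n ∧ Even (b - a) ∧ G.Adj (c a) (c b) ∧
      s(c a, c b) = s(c p, c (p + d : ℕ)) := by
  have hz : ((2 * n : ℕ) : ZMod (2 * n)) = 0 := ZMod.natCast_self _
  have hlt := Nat.mod_lt p (by omega : 0 < 2 * n)
  have hp : ((p % (2 * n) : ℕ) : ZMod (2 * n)) = p := ZMod.natCast_mod p (2 * n)
  push_cast at hadj ⊢
  rw [← hp] at hadj ⊢
  generalize p % (2 * n) = a at *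
  obtain ⟨k, hk⟩ := hde
  rcases Nat.lt_or_ge (a + d) (2 * n) with h | h
  · exact ⟨a, a + d, by omega, h, ⟨k, by omega⟩, by push_cast; exact hadj, by push_cast; rfl⟩
  · refine ⟨a + d - 2 * n, a, by omega, hlt, ⟨n - k, by omega⟩, ?_, ?_⟩
    · rw [Nat.cast_sub h, hz, sub_zero]
      push_cast
      exact hadj.symm
    · rw [Nat.cast_sub h, hz, sub_zero, Sym2.eq_swap]
      push_cast
      rfl

theorem HasCrossing.of_lt {c : ZMod (2 * n) → V} (hc : Function.Injective c)
    {a b a' b' p d : ℕ} (h1 : a < a') (h2 : a' < b) (h3 : b < b') (hb' : b' < 2 * n)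
    (he : Even (b - a)) (he' : Even (b' - a')) (hadj : G.Adj (c a) (c b))
    (hadj' : G.Adj (c a') (c b'))
    (hcyc : s(c a, c a') ∈ cycEdges (2 * n) c ∧ s(c b, c b') ∈ cycEdges (2 * n) c ∨
      s(c a, c b') ∈ cycEdges (2 * n) c ∧ s(c a', c b) ∈ cycEdges (2 * n) c)
    (hde : Even d) (hd0 : 0 < d) (hdn : d < 2 * n) (hp : G.Adj (c p) (c (p + d : ℕ)))
    (hne : s(c a, c b) ≠ s(c p, c (p + d : ℕ))) (hne' : s(c a', c b') ≠ s(c p, c (p + d : ℕ))) :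
    HasCrossing G n fun k => c k := by
  have hz : ((2 * n : ℕ) : ZMod (2 * n)) = 0 := ZMod.natCast_self _
  obtain ⟨k, hk⟩ := he
  obtain ⟨k', hk'⟩ := he'
  rw [mem_cycEdges_iff hc h1 (by omega), mem_cycEdges_iff hc h3 hb',
    mem_cycEdges_iff hc (by omega : a < b') hb', mem_cycEdges_iff hc h2 (by omega)] at hcyc
  rcases hcyc with ⟨e1, e2⟩ | ⟨e1, e2⟩
  · obtain rfl : a' = a + 1 := by omega
    obtain rfl : b' = b + 1 := by omega
    refine ⟨a, b - a, ⟨k, hk⟩, by omega, by omega, ?_, ?_, p, d, hde, hd0, hdn, hp, ?_⟩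
    · rwa [Nat.add_sub_cancel' (by omega)]
    · rwa [Nat.add_sub_cancel' (by omega)]
    · rw [Nat.add_sub_cancel' (by omega)]
      exact ⟨hne.symm, hne'.symm⟩
  · obtain rfl : a = 0 := by omega
    obtain rfl : b = a' + 1 := by omega
    have e3 : ((b' + (a' + 1) : ℕ) : ZMod (2 * n)) = a' := by
      rw [show b' + (a' + 1) = a' + 2 * n by omega, Nat.cast_add, hz, add_zero]
    have e4 : ((b' + (a' + 1) + 1 : ℕ) : ZMod (2 * n)) = (a' + 1 : ℕ) := by
      rw [show b' + (a' + 1) + 1 = a' + 1 + 2 * n by omega, Nat.cast_add, hz, add_zero]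
    have e5 : ((b' + 1 : ℕ) : ZMod (2 * n)) = (0 : ℕ) := by
      rw [show b' + 1 = 2 * n by omega, hz, Nat.cast_zero]
    refine ⟨b', a' + 1, ⟨k, by omega⟩, by omega, by omega, ?_, ?_, p, d, hde, hd0, hdn, hp, ?_⟩
    · show G.Adj (c b') (c (b' + (a' + 1) : ℕ))
      rw [e3]; exact hadj'.symm
    · show G.Adj (c (b' + 1 : ℕ)) (c (b' + (a' + 1) + 1 : ℕ))
      rw [e4, e5]; exact hadj
    · show s(c p, c (p + d : ℕ)) ≠ s(c b', c (b' + (a' + 1) : ℕ)) ∧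
        s(c p, c (p + d : ℕ)) ≠ s(c (b' + 1 : ℕ), c (b' + (a' + 1) + 1 : ℕ))
      rw [e3, e4, e5]
      exact ⟨fun h => hne' (Sym2.eq_swap.trans h.symm), hne.symm⟩

theorem exists_crossPairs_iff (hn : 0 < n) {c : ZMod (2 * n) → V} (hc : Function.Injective c) :
    (∃ i j i' j' i'' j'' : ZMod (2 * n),
      IsOddChordPair G (2 * n) c i j ∧ IsOddChordPair G (2 * n) c i' j' ∧
      IsOddChordPair G (2 * n) c i'' j'' ∧
      s(c i, c j) ≠ s(c i', c j') ∧ s(c i, c j) ≠ s(c i'', c j'') ∧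
      s(c i', c j') ≠ s(c i'', c j'') ∧
      CrossPairs (2 * n) c i j i' j') ↔ HasCrossing G n fun k => c k := by
  have : NeZero (2 * n) := ⟨by omega⟩
  have hz : ((2 * n : ℕ) : ZMod (2 * n)) = 0 := ZMod.natCast_self _
  constructor
  · rintro ⟨i, j, i', j', i'', j'', h1, h2, h3, -, hne, hne', hcr, hcyc⟩
    have hi := i.val_lt
    have hj := j.val_lt
    have hi' := i'.val_lt
    have hj' := j'.val_lt
    have hi'' := i''.val_lt
    have hj'' := j''.val_lt
    obtain ⟨a, ha⟩ : ∃ a : ℕ, i = (a : ZMod (2 * n)) ∧ i.val = a := ⟨i.val, by simp, rfl⟩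
    obtain ⟨b, hb⟩ : ∃ a : ℕ, j = (a : ZMod (2 * n)) ∧ j.val = a := ⟨j.val, by simp, rfl⟩
    obtain ⟨a', ha'⟩ : ∃ a : ℕ, i' = (a : ZMod (2 * n)) ∧ i'.val = a := ⟨i'.val, by simp, rfl⟩
    obtain ⟨b', hb'⟩ : ∃ a : ℕ, j' = (a : ZMod (2 * n)) ∧ j'.val = a := ⟨j'.val, by simp, rfl⟩
    obtain ⟨p, hp⟩ : ∃ a : ℕ, i'' = (a : ZMod (2 * n)) ∧ i''.val = a := ⟨i''.val, by simp, rfl⟩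
    obtain ⟨q, hq⟩ : ∃ a : ℕ, j'' = (a : ZMod (2 * n)) ∧ j''.val = a := ⟨j''.val, by simp, rfl⟩
    rw [ha.2] at hi hcr
    rw [hb.2] at hj hcr
    rw [ha'.2] at hi' hcr
    rw [hb'.2] at hj' hcr
    rw [hp.2] at hi''
    rw [hq.2] at hj''
    obtain ⟨rfl, -⟩ := ha
    obtain ⟨rfl, -⟩ := hb
    obtain ⟨rfl, -⟩ := ha'
    obtain ⟨rfl, -⟩ := hb'
    obtain ⟨rfl, -⟩ := hp
    obtain ⟨rfl, -⟩ := hq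
    rw [isOddChordPair_iff hc (by assumption) (by assumption)] at h1 h2 h3
    obtain ⟨d, rfl⟩ := Nat.exists_eq_add_of_le h3.1.le
    have h4 := h3.2.1
    rw [Nat.add_sub_cancel_left] at h4
    rcases hcr with ⟨g1, g2, g3⟩ | ⟨g1, g2, g3⟩
    · refine HasCrossing.of_lt hc g1 g2 g3 hj' h1.2.1 h2.2.1 h1.2.2 h2.2.2 ?_ h4 (by omega)
        (by omega) h3.2.2 hne hne'
      rwa [Sym2.eq_swap (a := c a') (b := c b)]
    · refine HasCrossing.of_lt hc g1 g2 g3 hj h2.2.1 h1.2.1 h2.2.2 h1.2.2 ?_ h4 (by omega)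
        (by omega) h3.2.2 hne' hne
      rw [Sym2.eq_swap (a := c a') (b := c a), Sym2.eq_swap (a := c b') (b := c b),
        Sym2.eq_swap (a := c a') (b := c b)]
      exact hcyc.imp_right And.symm
  · rintro ⟨r, t, ht, ht2, htn, h1, h2, p, d, hde, hd0, hdn, hp, hne1, hne2⟩
    obtain ⟨a'', b'', h3, h4, h5, h6, h7⟩ := exists_lt_of_even c hde hd0 hdn hp
    dsimp only at hne1 hne2
    rw [← h7] at hne1 hne2
    have key : ∀ a t, Even t → 2 ≤ t → t + 2 ≤ 2 * n → a + t < 2 * n →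
        G.Adj (c a) (c (a + t : ℕ)) → G.Adj (c (a + 1 : ℕ)) (c (a + t + 1 : ℕ)) →
        s(c a'', c b'') ≠ s(c a, c (a + t : ℕ)) →
        s(c a'', c b'') ≠ s(c (a + 1 : ℕ), c (a + t + 1 : ℕ)) →
        ∃ i j i' j' i'' j'' : ZMod (2 * n),
          IsOddChordPair G (2 * n) c i j ∧ IsOddChordPair G (2 * n) c i' j' ∧
          IsOddChordPair G (2 * n) c i'' j'' ∧
          s(c i, c j) ≠ s(c i', c j') ∧ s(c i, c j) ≠ s(c i'', c j'') ∧
          s(c i', c j') ≠ s(c i'', c j'') ∧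
          CrossPairs (2 * n) c i j i' j' := by
      clear h1 h2 hne1 hne2 ht ht2 htn
      intro a t ht ht2 htn hlt h1 h2 hne1 hne2
      have hcast : ∀ {x y : ℕ}, x < 2 * n → y < 2 * n →
          c (x : ZMod (2 * n)) = c (y : ZMod (2 * n)) → x = y := by
        intro x y hx hy h
        have := (ZMod.natCast_eq_natCast_iff' x y (2 * n)).1 (hc h)
        rwa [Nat.mod_eq_of_lt hx, Nat.mod_eq_of_lt hy] at this
      rcases Nat.lt_or_ge (a + t + 1) (2 * n) with hlt' | hge
      · refine ⟨a, (a + t : ℕ), (a + 1 : ℕ), (a + t + 1 : ℕ), a'', b'',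
          (isOddChordPair_iff hc (by omega) hlt).2 ⟨by omega, by simpa using ht, h1⟩,
          (isOddChordPair_iff hc (by omega) hlt').2 ⟨by omega, ?_, h2⟩,
          (isOddChordPair_iff hc (by omega) h4).2 ⟨h3, h5, h6⟩, ?_, hne1.symm, hne2.symm, ?_, ?_⟩
        · rwa [show a + t + 1 - (a + 1) = t by omega]
        · intro h
          rcases Sym2.eq_iff.1 h with ⟨g1, -⟩ | ⟨g1, -⟩
          · have := hcast (by omega) (by omega) g1; omega
          · have := hcast (by omega) (by omega) g1; omega
        · left
          rw [ZMod.val_natCast_of_lt (by omega), ZMod.val_natCast_of_lt (by omega),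
            ZMod.val_natCast_of_lt (by omega), ZMod.val_natCast_of_lt (by omega)]
          omega
        · left
          exact ⟨(mem_cycEdges_iff hc (by omega) (by omega)).2 (Or.inl rfl),
            (mem_cycEdges_iff hc (by omega) (by omega)).2 (Or.inl rfl)⟩
      · have e : ((a + t + 1 : ℕ) : ZMod (2 * n)) = (0 : ℕ) := by
          rw [show a + t + 1 = 2 * n by omega, hz, Nat.cast_zero]
        rw [e] at h2 hne2
        obtain ⟨k, hk⟩ := ht
        refine ⟨a, (a + t : ℕ), (0 : ℕ), (a + 1 : ℕ), a'', b'',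
          (isOddChordPair_iff hc (by omega) hlt).2 ⟨by omega, by simpa using ⟨k, hk⟩, h1⟩,
          (isOddChordPair_iff hc (by omega) (by omega)).2 ⟨by omega, ⟨n - k, by omega⟩, h2.symm⟩,
          (isOddChordPair_iff hc (by omega) h4).2 ⟨h3, h5, h6⟩, ?_, hne1.symm, ?_, ?_, ?_⟩
        · intro h
          rcases Sym2.eq_iff.1 h with ⟨g1, -⟩ | ⟨g1, -⟩
          · have := hcast (by omega) (by omega) g1; omega
          · have := hcast (by omega) (by omega) g1; omega
        · exact fun h => hne2 (h.symm.trans Sym2.eq_swap)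
        · right
          rw [ZMod.val_natCast_of_lt (by omega), ZMod.val_natCast_of_lt (by omega),
            ZMod.val_natCast_of_lt (by omega), ZMod.val_natCast_of_lt (by omega)]
          omega
        · right
          refine ⟨(mem_cycEdges_iff hc (by omega) (by omega)).2 (Or.inl rfl), ?_⟩
          rw [Sym2.eq_swap]
          exact (mem_cycEdges_iff hc (by omega) (by omega)).2 (Or.inr ⟨rfl, by omega⟩)
    have hlt := Nat.mod_lt r (by omega : 0 < 2 * n)
    have hr : ((r % (2 * n) : ℕ) : ZMod (2 * n)) = r := ZMod.natCast_mod r (2 * n)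
    push_cast at h1 h2 hne1 hne2
    rw [← hr] at h1 h2 hne1 hne2
    generalize r % (2 * n) = a at *
    rcases Nat.lt_or_ge (a + t) (2 * n) with h | h
    · exact key a t ht ht2 htn h (by exact_mod_cast h1) (by exact_mod_cast h2)
        (by exact_mod_cast hne1) (by exact_mod_cast hne2)
    · have e1 : ((a + t - 2 * n : ℕ) : ZMod (2 * n)) = a + t := by
        rw [Nat.cast_sub h, hz, sub_zero, Nat.cast_add]
      have e2 : a + t - 2 * n + (2 * n - t) = a := by omega
      obtain ⟨k, hk⟩ := ht
      refine key (a + t - 2 * n) (2 * n - t) ⟨n - k, by omega⟩ (by omega) (by omega) (by omega)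
        ?_ ?_ ?_ ?_
      · rw [e2, e1]; exact h1.symm
      · rw [e2]; push_cast; rw [e1]; exact h2.symm
      · rw [e2, e1, Sym2.eq_swap (b := c (a : ZMod (2 * n)))]; exact hne1
      · rw [e2]; push_cast; rw [e1, Sym2.eq_swap (b := c ((a : ZMod (2 * n)) + 1))]; exact hne2

theorem condEvenCycles_iff : CondEvenCycles G ↔ ∀ (n : ℕ) (w : ℕ → V), 3 ≤ n →
    (∀ k, G.Adj (w k) (w (k + 1))) → (∀ k, w (k + 2 * n) = w k) →
    (∀ i d, 0 < d → d < 2 * n → w i ≠ w (i + d)) →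
    HasEvenChord G n w ∨ HasCrossing G n w := by
  constructor
  · intro h n w hn hadj hper hinj
    have : NeZero (2 * n) := ⟨by omega⟩
    have hmod : ∀ k, w (k % (2 * n)) = w k := (Function.Periodic.map_mod_nat hper)
    have hw : (fun k : ℕ => (fun i : ZMod (2 * n) => w i.val) k) = w := by
      funext k
      simp only [ZMod.val_natCast, hmod]
    have hc : Function.Injective fun i : ZMod (2 * n) => w i.val := by
      intro i j hij
      have hi := i.val_lt
      have hj := j.val_lt
      apply ZMod.val_injective
      by_contra hne
      rcases Nat.lt_or_gt_of_ne hne with h1 | h1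
      · apply hinj i.val (j.val - i.val) (by omega) (by omega)
        rw [Nat.add_sub_cancel' h1.le]; exact hij
      · apply hinj j.val (i.val - j.val) (by omega) (by omega)
        rw [Nat.add_sub_cancel' h1.le]; exact hij.symm
    have := h (2 * n) (fun i => w i.val) ⟨by omega, hc, fun i => ?_⟩ (by omega) ⟨n, by omega⟩
    · rw [exists_isEvenChord_iff (by omega) hc, exists_crossPairs_iff (by omega) hc, hw] at this
      exact this
    · have h1 : (1 : ZMod (2 * n)).val = 1 := ZMod.val_one'' (by omega)
      show G.Adj (w i.val) (w (i + 1).val)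
      rw [ZMod.val_add, h1, hmod]
      exact hadj _
  · rintro h q c ⟨-, hc, hadj⟩ hq ⟨n, hn⟩
    obtain rfl : q = 2 * n := by omega
    rw [exists_isEvenChord_iff (by omega) hc, exists_crossPairs_iff (by omega) hc]
    refine h n _ (by omega) (fun k => by push_cast; exact hadj _) (fun k => ?_) ?_
    · rw [Nat.cast_add, ZMod.natCast_self, add_zero]
    · intro i d hd0 hdn heq
      have := hc heq
      rw [Nat.cast_add] at this
      have := left_eq_add.1 this
      rw [ZMod.natCast_eq_zero_iff] at this
      exact absurd (Nat.le_of_dvd hd0 this) (by omega)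

end EvenCycles

/-! ### Balancedness of closed walks -/

section Balanced

variable {V A : Type*} [CommMonoid A] {G : SimpleGraph V} {x : V → V → A}

theorem IsClosedWalk.isUnbalanced {n : ℕ} {f : ℕ → V} (hf : IsClosedWalk G n f) (hn : 0 < n)
    (hb : ¬ IsBalanced x n f) : IsUnbalanced G x n fun k => f (k % (2 * n)) := by
  have hext : ∀ k ≤ 2 * n, f (k % (2 * n)) = f k := by
    intro k hk
    rcases hk.lt_or_eq with h | rfl
    · rw [Nat.mod_eq_of_lt h]
    · rw [Nat.mod_self, hf.closed]
  refine ⟨fun k => ?_, fun k => by rw [Nat.add_mod_right], fun h => hb ?_⟩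
  · have hlt := Nat.mod_lt k (by omega : 0 < 2 * n)
    have := hf.adj _ hlt
    rwa [← hext (k % (2 * n) + 1) hlt, Nat.mod_add_mod] at this
  · unfold IsBalanced at h ⊢
    rwa [altProd_congr x 0 fun k _ hk => hext k hk, altProd_congr x 1 fun k _ hk => hext k hk] at h

theorem IsClosedWalk.isBalanced (hc : CondEvenCycles G) (hm : CondOddCyclesMeet G)
    (hd : CondOddCyclesDisjoint G) (hx : ∀ a b, x a b = x b a)
    (hq : ∀ a b c d, G.Adj a b → G.Adj b c → G.Adj c d → G.Adj d a →
      x a b * x c d = x b c * x d a) (n : ℕ) (f : ℕ → V) (hf : IsClosedWalk G n f) :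
    IsBalanced x n f := by
  induction n using Nat.strong_induction_on generalizing f with
  | _ n ih =>
    by_contra hb
    have hn : 3 ≤ n := by
      by_contra hlt
      apply hb
      have h0 := hf.closed
      unfold IsBalanced
      rw [altProd_zero_range, altProd_one_range]
      interval_cases n
      · simp
      · simp only [Finset.prod_range_one, mul_zero, zero_add] at h0 ⊢
        rw [h0, hx]
      · simp only [Finset.prod_range_succ, Finset.prod_range_zero, one_mul] at h0 ⊢
        rw [← hf.closed]
        exact hq _ _ _ _ (by have := hf.adj 0 (by norm_num); rwa [← hf.closed] at this)
          (hf.adj 1 (by norm_num)) (hf.adj 2 (by norm_num)) (hf.adj 3 (by norm_num))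
    have hw := (hf.isUnbalanced (by omega) hb).isRigid hx hq ih
    have hinj := hw.apply_ne hm hd
    rcases condEvenCycles_iff.1 hc n _ hn hw.adj hw.per hinj with ⟨i, d, h1, h2, h3, h4⟩ | h
    · exact hw.not_adj i d h1 h2 h3 h4
    · exact hw.not_hasCrossing hm hd hinj h

end Balanced

/-! ### Multisets of edges with equal degrees -/

section Trail

variable {V A : Type*} [CommMonoid A] {G : SimpleGraph V}

/-- There is a walk of length `2 * m` from `a` to `b` along which the edges in even position have
product `r` and those in odd position have product `s`. -/
def IsTrail (G : SimpleGraph V) (X : Sym2 V → A) (a b : V) (m : ℕ) (r s : A) : Prop :=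
  ∃ f : ℕ → V, f 0 = a ∧ f (2 * m) = b ∧ (∀ k < 2 * m, G.Adj (f k) (f (k + 1))) ∧
    r = ∏ k ∈ Finset.range m, X s(f (2 * k), f (2 * k + 1)) ∧
    s = ∏ k ∈ Finset.range m, X s(f (2 * k + 1), f (2 * k + 2))

theorem IsTrail.cons {X : Sym2 V → A} {a b c d : V} {m : ℕ} {r s : A}
    (h : IsTrail G X a b m r s) (hcd : G.Adj c d) (hda : G.Adj d a) :
    IsTrail G X c b (m + 1) (X s(c, d) * r) (X s(d, a) * s) := by
  obtain ⟨f, rfl, rfl, hf, rfl, rfl⟩ := h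
  refine ⟨fun k => if k = 0 then c else if k = 1 then d else f (k - 2), rfl, ?_, ?_, ?_, ?_⟩
  · simp [show 2 * (m + 1) ≠ 1 by omega, show 2 * (m + 1) - 2 = 2 * m by omega]
  · rintro (_ | _ | k) hk
    · simpa using hcd
    · simpa using hda
    · simpa using hf k (by omega)
  · rw [Finset.prod_range_succ', mul_comm]
    simp [show ∀ k, 2 * (k + 1) ≠ 1 by omega, show ∀ k, 2 * (k + 1) - 2 = 2 * k by omega,
      show ∀ k, 2 * (k + 1) - 1 = 2 * k + 1 by omega]
  · rw [Finset.prod_range_succ', mul_comm]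
    simp [show ∀ k, 2 * (k + 1) - 1 = 2 * k + 1 by omega]
    rfl

theorem exists_cons_of_mem_bind {a : V} {R : Multiset (Sym2 V)}
    (h : a ∈ R.bind Sym2.toMultiset) : ∃ b R', R = s(a, b) ::ₘ R' := by
  obtain ⟨e, he, hae⟩ := Multiset.mem_bind.1 h
  obtain ⟨R', rfl⟩ := Multiset.exists_cons_of_mem he
  obtain ⟨b, rfl⟩ := Sym2.mem_toMultiset.1 hae
  exact ⟨b, R', rfl⟩

theorem cons_bind_toMultiset (a b : V) (R : Multiset (Sym2 V)) :
    (s(a, b) ::ₘ R).bind Sym2.toMultiset = a ::ₘ b ::ₘ R.bind Sym2.toMultiset := by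
  rw [Multiset.cons_bind]
  show (a ::ₘ b ::ₘ 0) + _ = _
  simp

theorem exists_isTrail (X : Sym2 V → A) (v : V) (R B : Multiset (Sym2 V)) (a : V)
    (hR : ∀ e ∈ R, e ∈ G.edgeSet) (hB : ∀ e ∈ B, e ∈ G.edgeSet)
    (h : v ::ₘ R.bind Sym2.toMultiset = a ::ₘ B.bind Sym2.toMultiset) :
    ∃ m r s R' B', IsTrail G X a v m r s ∧ (R.map X).prod = r * (R'.map X).prod ∧
      (B.map X).prod = s * (B'.map X).prod ∧ R' ≤ R ∧ B' ≤ B ∧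
      R'.bind Sym2.toMultiset = B'.bind Sym2.toMultiset := by
  induction hk : R.card using Nat.strong_induction_on generalizing R B a with
  | _ k ih =>
    by_cases hav : a = v
    · subst hav
      exact ⟨0, 1, 1, R, B, ⟨fun _ => a, rfl, rfl, by simp, by simp, by simp⟩, by simp, by simp,
        le_rfl, le_rfl, (Multiset.cons_inj_right a).1 h⟩
    · have h1 : a ∈ R.bind Sym2.toMultiset :=
        (Multiset.mem_cons.1 (h ▸ Multiset.mem_cons_self a _)).resolve_left hav
      obtain ⟨b, R, rfl⟩ := exists_cons_of_mem_bind h1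
      rw [cons_bind_toMultiset, Multiset.cons_swap, Multiset.cons_inj_right] at h
      have h2 : b ∈ B.bind Sym2.toMultiset :=
        h ▸ Multiset.mem_cons_of_mem (Multiset.mem_cons_self b _)
      obtain ⟨c, B, rfl⟩ := exists_cons_of_mem_bind h2
      rw [cons_bind_toMultiset, Multiset.cons_swap, Multiset.cons_inj_right] at h
      rw [Multiset.card_cons] at hk
      obtain ⟨m, r, s, R', B', h3, h4, h5, h6, h7, h8⟩ := ih R.card (by omega) R B c
        (fun e he => hR e (Multiset.mem_cons_of_mem he))
        (fun e he => hB e (Multiset.mem_cons_of_mem he)) h rfl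
      refine ⟨m + 1, _, _, R', B', h3.cons (hR _ (Multiset.mem_cons_self _ _))
        (hB _ (Multiset.mem_cons_self _ _)), ?_, ?_, h6.trans (Multiset.le_cons_self _ _),
        h7.trans (Multiset.le_cons_self _ _), h8⟩
      · rw [Multiset.map_cons, Multiset.prod_cons, h4, mul_assoc]
      · rw [Multiset.map_cons, Multiset.prod_cons, h5, mul_assoc]

theorem prod_map_eq_of_bind_eq {X : Sym2 V → A}
    (hX : ∀ n f, IsClosedWalk G n f → IsBalanced (fun a b => X s(a, b)) n f)
    (R B : Multiset (Sym2 V)) (hR : ∀ e ∈ R, e ∈ G.edgeSet) (hB : ∀ e ∈ B, e ∈ G.edgeSet)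
    (h : R.bind Sym2.toMultiset = B.bind Sym2.toMultiset) :
    (R.map X).prod = (B.map X).prod := by
  induction hk : R.card using Nat.strong_induction_on generalizing R B with
  | _ k ih =>
    induction R using Multiset.induction_on with
    | empty =>
      rcases B.empty_or_exists_mem with rfl | ⟨e, he⟩
      · rfl
      · obtain ⟨B, rfl⟩ := Multiset.exists_cons_of_mem he
        induction e with
        | _ a b =>
          rw [cons_bind_toMultiset] at h
          exact absurd h (Multiset.zero_ne_cons)
    | cons e R _ =>
      induction e with
      | _ v b =>
        rw [cons_bind_toMultiset] at h
        have h2 : b ∈ B.bind Sym2.toMultiset :=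
          h ▸ Multiset.mem_cons_of_mem (Multiset.mem_cons_self b _)
        obtain ⟨c, B, rfl⟩ := exists_cons_of_mem_bind h2
        rw [cons_bind_toMultiset, Multiset.cons_swap, Multiset.cons_inj_right] at h
        rw [Multiset.card_cons] at hk
        obtain ⟨m, r, s, R', B', h3, h4, h5, h6, h7, h8⟩ := exists_isTrail (G := G) X v R B c
          (fun e he => hR e (Multiset.mem_cons_of_mem he))
          (fun e he => hB e (Multiset.mem_cons_of_mem he)) h
        have h9 := ih R'.card (by have := Multiset.card_le_card h6; omega) R' B'
          (fun e he => hR e (Multiset.mem_cons_of_mem (Multiset.mem_of_le h6 he)))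
          (fun e he => hB e (Multiset.mem_cons_of_mem (Multiset.mem_of_le h7 he))) h8 rfl
        obtain ⟨f, hf0, hfm, hf, hr, hs⟩ := h3.cons (hR _ (Multiset.mem_cons_self _ _))
          (hB _ (Multiset.mem_cons_self _ _))
        have := hX (m + 1) f ⟨hf, hfm.trans hf0.symm⟩
        unfold IsBalanced at this
        rw [altProd_zero_range, altProd_one_range, ← hr, ← hs] at this
        rw [Multiset.map_cons, Multiset.prod_cons, h4, Multiset.map_cons, Multiset.prod_cons, h5,
          ← mul_assoc, ← mul_assoc, this, h9]

end Trail

/-! ### Exponents of monomials in the edge variables -/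

section Exponent

variable {V : Type*} {G : SimpleGraph V} (K : Type*) [Field K]

/-- The multiset of edges encoded by an exponent. -/
noncomputable def edgeMultiset (m : G.edgeSet →₀ ℕ) : Multiset (Sym2 V) :=
  (Finsupp.toMultiset m).map Subtype.val

/-- The multiset of end points of the edges encoded by an exponent. -/
noncomputable def vertexMultiset (m : G.edgeSet →₀ ℕ) : Multiset V :=
  (edgeMultiset m).bind Sym2.toMultiset

theorem vertexMultiset_add (m m' : G.edgeSet →₀ ℕ) :
    vertexMultiset (m + m') = vertexMultiset m + vertexMultiset m' := by
  simp [vertexMultiset, edgeMultiset]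

theorem vertexMultiset_single {a b : V} (h : G.Adj a b) :
    vertexMultiset (Finsupp.single (⟨s(a, b), h⟩ : G.edgeSet) 1) = {a, b} := by
  simp [vertexMultiset, edgeMultiset]
  rfl

theorem edgeMon_eq_prod (e : Sym2 V) : edgeMon K e = ((Sym2.toMultiset e).map X).prod := by
  induction e with
  | _ a b =>
    show X a * X b = (Multiset.map X {a, b}).prod
    simp

theorem aeval_monomial_eq_prod (m : G.edgeSet →₀ ℕ) (r : K) :
    aeval (fun e : G.edgeSet => edgeMon K e.1) (monomial m r) =
      C r * ((vertexMultiset m).map (X : V → MvPolynomial V K)).prod := by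
  rw [aeval_monomial, algebraMap_eq]
  congr 1
  induction m using Finsupp.induction_linear with
  | zero => simp [vertexMultiset, edgeMultiset]
  | add m m' h h' =>
    rw [vertexMultiset_add, Multiset.map_add, Multiset.prod_add, ← h, ← h']
    exact Finsupp.prod_add_index' (by simp) (by simp [pow_add])
  | single e k =>
    rw [Finsupp.prod_single_index (h := fun (i : G.edgeSet) k => edgeMon K i.1 ^ k) (pow_zero _)]
    induction k with
    | zero => simp [vertexMultiset, edgeMultiset]
    | succ k ih =>
      rw [Finsupp.single_add, vertexMultiset_add, Multiset.map_add, Multiset.prod_add, ← ih]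
      simp [vertexMultiset, edgeMultiset, pow_succ, edgeMon_eq_prod]

theorem prod_map_X_eq_monomial [DecidableEq V] (D : Multiset V) :
    (D.map (X : V → MvPolynomial V K)).prod = monomial (Multiset.toFinsupp D) 1 := by
  induction D using Multiset.induction_on with
  | empty => simp
  | cons a D ih =>
    rw [Multiset.map_cons, Multiset.prod_cons, ih, ← Multiset.singleton_add, map_add,
      Multiset.toFinsupp_singleton, X, monomial_mul, one_mul]

open Classical in
theorem aeval_monomial_eq_monomial (m : G.edgeSet →₀ ℕ) (r : K) :
    aeval (fun e : G.edgeSet => edgeMon K e.1) (monomial m r) =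
      monomial (Multiset.toFinsupp (vertexMultiset m)) r := by
  rw [aeval_monomial_eq_prod, prod_map_X_eq_monomial, C_mul_monomial, mul_one]

theorem monomial_sub_monomial_mem_toricIdeal {u v : G.edgeSet →₀ ℕ} :
    monomial u 1 - monomial v 1 ∈ toricIdeal K G ↔ vertexMultiset u = vertexMultiset v := by
  classical
  rw [toricIdeal, RingHom.mem_ker, map_sub, aeval_monomial_eq_monomial, aeval_monomial_eq_monomial,
    sub_eq_zero]
  constructor
  · intro h
    exact Multiset.toFinsupp.injective (monomial_left_injective one_ne_zero h)
  · intro h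
    rw [h]

theorem X_mul_X_sub_mem_toricIdeal {i j k l : G.edgeSet} :
    X i * X j - X k * X l ∈ toricIdeal K G ↔
      Sym2.toMultiset i.1 + Sym2.toMultiset j.1 = Sym2.toMultiset k.1 + Sym2.toMultiset l.1 := by
  rw [X, X, X, X, monomial_mul, monomial_mul, one_mul, monomial_sub_monomial_mem_toricIdeal]
  simp [vertexMultiset, edgeMultiset]

end Exponent

/-! ### Sufficiency of the conditions -/

section Sufficiency

variable {V : Type*} {G : SimpleGraph V} (K : Type*) [Field K]

theorem isQuadBinomialGen_of_cond (hc : CondEvenCycles G) (hm : CondOddCyclesMeet G)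
    (hd : CondOddCyclesDisjoint G) : IsQuadBinomialGen (toricIdeal K G) := by
  classical
  let S : Set (MvPolynomial G.edgeSet K) :=
    {f | f ∈ toricIdeal K G ∧ ∃ i j k l, f = X i * X j - X k * X l}
  refine ⟨S, le_antisymm ?_ (Ideal.span_le.2 fun f hf => hf.1), fun f hf => hf.2⟩
  let mk := Ideal.Quotient.mkₐ K (Ideal.span S)
  let x : Sym2 V → MvPolynomial G.edgeSet K ⧸ Ideal.span S := fun e =>
    if h : e ∈ G.edgeSet then mk (X ⟨e, h⟩) else 1
  have hx : ∀ {a b : V} (h : G.Adj a b), x s(a, b) = mk (X ⟨s(a, b), h⟩) := fun h => dif_pos h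
  have hbal : ∀ n f, IsClosedWalk G n f → IsBalanced (fun a b => x s(a, b)) n f := by
    refine IsClosedWalk.isBalanced hc hm hd (fun a b => by rw [Sym2.eq_swap]) ?_
    intro a b c d hab hbc hcd hda
    rw [hx hab, hx hbc, hx hcd, hx hda, ← map_mul, ← map_mul]
    refine Ideal.Quotient.eq.2 (Ideal.subset_span ⟨?_, _, _, _, _, rfl⟩)
    rw [X_mul_X_sub_mem_toricIdeal]
    show ({a, b} : Multiset V) + {c, d} = {b, c} + {d, a}
    simp only [Multiset.insert_eq_cons, ← Multiset.singleton_add]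
    abel
  have hmk : ∀ m : G.edgeSet →₀ ℕ, mk (monomial m 1) = ((edgeMultiset m).map x).prod := by
    intro m
    induction m using Finsupp.induction_linear with
    | zero => simp [edgeMultiset]
    | add m m' h h' =>
      rw [← one_mul (1 : K), ← monomial_mul, map_mul, h, h']
      simp [edgeMultiset]
    | single e k =>
      rw [← X_pow_eq_monomial, map_pow]
      have : x e.1 = mk (X e) := dif_pos e.2
      simp [edgeMultiset, Multiset.map_nsmul, Multiset.prod_nsmul, this]
  let σ : (V →₀ ℕ) → MvPolynomial G.edgeSet K ⧸ Ideal.span S :=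
    Function.extend (fun m : G.edgeSet →₀ ℕ => Multiset.toFinsupp (vertexMultiset m))
      (fun m => mk (monomial m 1)) 0
  have hσ : ∀ m : G.edgeSet →₀ ℕ,
      σ (Multiset.toFinsupp (vertexMultiset m)) = mk (monomial m 1) := by
    refine Function.FactorsThrough.extend_apply (fun m m' h => ?_) _
    rw [hmk, hmk]
    refine prod_map_eq_of_bind_eq hbal _ _ ?_ ?_ (Multiset.toFinsupp.injective h)
    · intro e he
      obtain ⟨e, -, rfl⟩ := Multiset.mem_map.1 he
      exact e.2
    · intro e he
      obtain ⟨e, -, rfl⟩ := Multiset.mem_map.1 he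
      exact e.2
  let Λ := (basisMonomials V K).constr K σ
  have hΛ : Λ ∘ₗ (aeval (R := K) fun e : G.edgeSet => edgeMon K e.1).toLinearMap =
      mk.toLinearMap := by
    refine (basisMonomials G.edgeSet K).ext fun m => ?_
    have h1 := (basisMonomials V K).constr_basis K σ (Multiset.toFinsupp (vertexMultiset m))
    rw [coe_basisMonomials] at h1 ⊢
    simp only [LinearMap.comp_apply, AlgHom.toLinearMap_apply]
    rw [aeval_monomial_eq_monomial, ← hσ]
    exact h1
  intro f hf
  have h1 : mk f = Λ (aeval (R := K) (fun e : G.edgeSet => edgeMon K e.1) f) :=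
    (LinearMap.congr_fun hΛ f).symm
  have h2 : aeval (R := K) (fun e : G.edgeSet => edgeMon K e.1) f = 0 := hf
  rw [h2, map_zero] at h1
  exact Ideal.Quotient.eq_zero_iff_mem.1 h1

end Sufficiency

/-! ### Necessity of the conditions -/

section Necessity

variable {V : Type*} {G : SimpleGraph V} {K : Type*} [Field K]

/-- Sets of exponents stable under quadratic moves are unions of fibers if the toric ideal is
generated by quadratic binomials. -/
theorem IsQuadBinomialGen.mem_of_vertexMultiset_eq (h : IsQuadBinomialGen (toricIdeal K G))
    {T : Set (G.edgeSet →₀ ℕ)}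
    (hT : ∀ m (i j k l : G.edgeSet), Sym2.toMultiset i.1 + Sym2.toMultiset j.1 =
      Sym2.toMultiset k.1 + Sym2.toMultiset l.1 →
      m + (Finsupp.single i 1 + Finsupp.single j 1) ∈ T →
      m + (Finsupp.single k 1 + Finsupp.single l 1) ∈ T)
    {u v : G.edgeSet →₀ ℕ} (huv : vertexMultiset u = vertexMultiset v) (hu : u ∈ T) : v ∈ T := by
  classical
  obtain ⟨S, hS, hS'⟩ := h
  let φ := (basisMonomials G.edgeSet K).constr K fun m => if m ∈ T then (1 : K) else 0
  have hφ : ∀ m, φ (monomial m 1) = if m ∈ T then 1 else 0 := by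
    intro m
    have := (basisMonomials G.edgeSet K).constr_basis K (fun m => if m ∈ T then (1 : K) else 0) m
    rwa [coe_basisMonomials] at this
  have hker : ∀ f ∈ Ideal.span S, ∀ p, φ (p * f) = 0 := by
    intro f hf
    induction hf using Submodule.span_induction with
    | zero => simp
    | add f g _ _ hf hg => intro p; rw [mul_add, map_add, hf, hg, add_zero]
    | smul q f _ hf => intro p; rw [smul_eq_mul, ← mul_assoc, hf]
    | mem f hf =>
      obtain ⟨i, j, k, l, rfl⟩ := hS' f hf
      have hmem : X i * X j - X k * X l ∈ toricIdeal K G := hS ▸ Ideal.subset_span hf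
      rw [X_mul_X_sub_mem_toricIdeal] at hmem
      have : φ ∘ₗ LinearMap.mulRight K (X i * X j - X k * X l) = 0 := by
        refine (basisMonomials G.edgeSet K).ext fun m => ?_
        rw [coe_basisMonomials]
        simp only [LinearMap.comp_apply, LinearMap.mulRight_apply, LinearMap.zero_apply]
        rw [X, X, X, X, monomial_mul, monomial_mul, mul_sub, monomial_mul, monomial_mul, map_sub,
          one_mul, one_mul, hφ, hφ, sub_eq_zero]
        simp only [show m + (Finsupp.single i 1 + Finsupp.single j 1) ∈ T ↔
          m + (Finsupp.single k 1 + Finsupp.single l 1) ∈ T from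
          ⟨hT m i j k l hmem, hT m k l i j hmem.symm⟩]
      exact fun p => LinearMap.congr_fun this p
  have h1 := (monomial_sub_monomial_mem_toricIdeal K).2 huv
  rw [hS] at h1
  have h2 := hker _ h1 1
  rw [one_mul, map_sub, hφ, hφ, if_pos hu] at h2
  by_contra hv
  rw [if_neg hv] at h2
  simp at h2

theorem toMultiset_mk (a b : V) : Sym2.toMultiset s(a, b) = {a, b} := rfl

theorem exchange {P : Sym2 V → Prop}
    (hP : ∀ a b c d, G.Adj a b → G.Adj c d → G.Adj a c → G.Adj b d → P s(a, b) → P s(c, d) →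
      P s(a, c))
    {i j k l : Sym2 V} (hi : i ∈ G.edgeSet) (hj : j ∈ G.edgeSet) (hk : k ∈ G.edgeSet)
    (hl : l ∈ G.edgeSet)
    (h : Sym2.toMultiset i + Sym2.toMultiset j = Sym2.toMultiset k + Sym2.toMultiset l)
    (hPi : P i) (hPj : P j) : P k := by
  induction k with
  | _ p q =>
    have hp : p ∈ Sym2.toMultiset i + Sym2.toMultiset j := by
      rw [h, toMultiset_mk]; simp
    wlog hpi : p ∈ Sym2.toMultiset i generalizing i j
    · rw [add_comm] at h hp
      exact this hj hi hPj hPi h hp ((Multiset.mem_add.1 hp).resolve_right hpi)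
    obtain ⟨b, rfl⟩ := Sym2.mem_toMultiset.1 hpi
    rw [toMultiset_mk, toMultiset_mk] at h
    simp only [Multiset.insert_eq_cons, Multiset.cons_add, Multiset.cons_inj_right,
      Multiset.singleton_add] at h
    by_cases hqb : q = b
    · rwa [hqb]
    have hq : q ∈ Sym2.toMultiset j :=
      (Multiset.mem_cons.1 (h ▸ Multiset.mem_cons_self q _)).resolve_left hqb
    obtain ⟨d, rfl⟩ := Sym2.mem_toMultiset.1 hq
    have hl' : G.Adj b d := by
      rw [toMultiset_mk, Multiset.insert_eq_cons, Multiset.cons_swap, Multiset.cons_inj_right] at h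
      induction l with
      | _ r t =>
        rw [toMultiset_mk] at h
        have hb : b ∈ ({r, t} : Multiset V) := h ▸ Multiset.mem_cons_self b _
        rw [Multiset.insert_eq_cons, Multiset.mem_cons, Multiset.mem_singleton] at hb
        rcases hb with rfl | rfl
        · rw [Multiset.insert_eq_cons, Multiset.cons_inj_right, Multiset.singleton_inj] at h
          rwa [h]
        · rw [Multiset.insert_eq_cons, ← Multiset.singleton_add b, add_comm,
            Multiset.singleton_add, Multiset.cons_inj_left] at h
          rw [h]
          exact SimpleGraph.Adj.symm hl
    exact hP p b q d hi hj hk hl' hPi hPj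

theorem IsQuadBinomialGen.forall_mem_support (h : IsQuadBinomialGen (toricIdeal K G))
    {P : Sym2 V → Prop}
    (hP : ∀ a b c d, G.Adj a b → G.Adj c d → G.Adj a c → G.Adj b d → P s(a, b) → P s(c, d) →
      P s(a, c))
    {u v : G.edgeSet →₀ ℕ} (huv : vertexMultiset u = vertexMultiset v)
    (hu : ∀ e ∈ u.support, P e.1) : ∀ e ∈ v.support, P e.1 := by
  classical
  refine h.mem_of_vertexMultiset_eq (T := {m | ∀ e ∈ m.support, P e.1}) ?_ huv hu
  intro m i j k l hmul hm e he
  have hm' : ∀ e : G.edgeSet,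
      (m + (Finsupp.single i 1 + Finsupp.single j 1) : G.edgeSet →₀ ℕ) e ≠ 0 → P e.1 :=
    fun e he => hm e (Finsupp.mem_support_iff.2 he)
  have hi : P i.1 := hm' i (by simp)
  have hj : P j.1 := hm' j (by simp)
  rw [Finsupp.mem_support_iff] at he
  by_cases hek : e = k
  · rw [hek]; exact exchange hP i.2 j.2 k.2 l.2 hmul hi hj
  by_cases hel : e = l
  · rw [hel]; exact exchange hP i.2 j.2 l.2 k.2 (hmul.trans (add_comm _ _)) hi hj
  · refine hm' e fun h0 => he ?_
    rw [Finsupp.add_apply] at h0 ⊢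
    rw [(Nat.add_eq_zero_iff.1 h0).1]
    simp [Ne.symm hek, Ne.symm hel]

/-! ### Exponents of walks -/

/-- The exponent of the product of the variables of every other edge of a walk, starting at
position `a`. -/
noncomputable def altExponent {w : ℕ → V} (hw : ∀ k, G.Adj (w k) (w (k + 1))) (a r : ℕ) :
    G.edgeSet →₀ ℕ :=
  ∑ k ∈ Finset.range r, Finsupp.single ⟨s(w (a + 2 * k), w (a + 2 * k + 1)), hw _⟩ 1

variable {w : ℕ → V} (hw : ∀ k, G.Adj (w k) (w (k + 1)))

theorem vertexMultiset_altExponent (a r : ℕ) :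
    vertexMultiset (altExponent hw a r) = (Multiset.range (2 * r)).map fun k => w (a + k) := by
  unfold altExponent
  induction r with
  | zero => rfl
  | succ r ih =>
    rw [Finset.sum_range_succ, vertexMultiset_add, ih, vertexMultiset_single,
      show 2 * (r + 1) = 2 * r + 1 + 1 by ring, Multiset.range_succ, Multiset.range_succ,
      Multiset.map_cons, Multiset.map_cons, Multiset.insert_eq_cons, add_comm, Multiset.cons_swap,
      Multiset.cons_add, Multiset.singleton_add, Multiset.cons_swap]
    rw [Multiset.cons_swap, ← add_assoc]

theorem exists_of_mem_support_altExponent {a r : ℕ} {e : G.edgeSet}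
    (he : e ∈ (altExponent hw a r).support) :
    ∃ k < r, e.1 = s(w (a + 2 * k), w (a + 2 * k + 1)) := by
  classical
  obtain ⟨k, hk, hke⟩ := Finset.mem_biUnion.1 (Finsupp.support_finsetSum he)
  refine ⟨k, Finset.mem_range.1 hk, ?_⟩
  rw [Finset.mem_singleton.1 (Finsupp.support_single_subset hke)]

theorem mem_support_altExponent {a r k : ℕ} (hk : k < r) :
    (⟨s(w (a + 2 * k), w (a + 2 * k + 1)), hw _⟩ : G.edgeSet) ∈ (altExponent hw a r).support := by
  rw [Finsupp.mem_support_iff, altExponent, Finsupp.finsetSum_apply]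
  refine (lt_of_lt_of_le ?_ (Finset.single_le_sum (fun _ _ => Nat.zero_le _)
    (Finset.mem_range.2 hk))).ne'
  simp

theorem map_range_succ_eq_cons {α : Type*} (f : ℕ → α) (r : ℕ) :
    (Multiset.range (r + 1)).map f = f 0 ::ₘ (Multiset.range r).map fun k => f (1 + k) := by
  induction r with
  | zero => rfl
  | succ r ih =>
    rw [Multiset.range_succ, Multiset.map_cons, ih, Multiset.range_succ, Multiset.map_cons,
      Multiset.cons_swap, add_comm 1 r]

theorem IsCycleOn'.exists_exponents {q : ℕ} {c : ZMod q → V} (hc : IsCycleOn' G q c)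
    (hq : Odd q) {p : V} (hp : p ∈ cycVerts q c) : ∃ E O : G.edgeSet →₀ ℕ,
    vertexMultiset E = p ::ₘ p ::ₘ vertexMultiset O ∧
    (∀ e ∈ E.support, ∀ x ∈ e.1, x ∈ cycVerts q c) ∧
    (∀ e ∈ O.support, ∀ x ∈ e.1, x ∈ cycVerts q c ∧ x ≠ p) ∧
    ∃ y ∈ cycVerts q c, ∃ h : G.Adj y p, (⟨s(y, p), h⟩ : G.edgeSet) ∈ E.support := by
  obtain ⟨i, rfl⟩ := hp
  obtain ⟨hq3, hinj, hadj⟩ := hc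
  obtain ⟨r, rfl⟩ := hq
  have hw : ∀ k : ℕ, G.Adj (c (i + k)) (c (i + (k + 1 : ℕ))) := by
    intro k
    rw [Nat.cast_add, Nat.cast_one, ← add_assoc]
    exact hadj _
  have hr : c (i + (2 * r + 1 : ℕ)) = c i := by rw [ZMod.natCast_self, add_zero]
  have h0 : c (i + (0 : ℕ)) = c i := by rw [Nat.cast_zero, add_zero]
  refine ⟨altExponent (w := fun k => c (i + k)) hw 0 (r + 1),
    altExponent (w := fun k => c (i + k)) hw 1 r, ?_, ?_, ?_, c (i + 1), ⟨_, rfl⟩, ?_⟩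
  · rw [vertexMultiset_altExponent, vertexMultiset_altExponent,
      show 2 * (r + 1) = 2 * r + 1 + 1 by ring, map_range_succ_eq_cons,
      Multiset.range_succ, Multiset.map_cons]
    simp only [zero_add, add_comm 1 (2 * r)]
    rw [hr, h0]
  · intro e he x hx
    obtain ⟨k, -, hk⟩ := exists_of_mem_support_altExponent _ he
    rw [hk, Sym2.mem_iff] at hx
    rcases hx with rfl | rfl <;> exact ⟨_, rfl⟩
  · intro e he x hx
    obtain ⟨k, hk, hke⟩ := exists_of_mem_support_altExponent _ he
    rw [hke, Sym2.mem_iff] at hx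
    have key : ∀ m : ℕ, 0 < m → m < 2 * r + 1 → c (i + m) ≠ c i := by
      intro m hm hmr heq
      have := add_eq_left.1 (hinj heq)
      rw [ZMod.natCast_eq_zero_iff] at this
      exact absurd (Nat.le_of_dvd hm this) (by omega)
    rcases hx with rfl | rfl
    · exact ⟨⟨_, rfl⟩, key _ (by omega) (by omega)⟩
    · exact ⟨⟨_, rfl⟩, key _ (by omega) (by omega)⟩
  · refine ⟨(hadj i).symm, ?_⟩
    have := mem_support_altExponent (w := fun k => c (i + k)) hw (a := 0) (r := r + 1)
      (k := 0) (by omega)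
    convert this using 2
    simp [Sym2.eq_swap]

/-! ### Pairs of odd cycles -/

theorem not_isQuadBinomialGen_of_separated {S T : Set V} (hST : ∀ x ∈ S, x ∉ T) {p : V}
    (hadj : ∀ x ∈ S, ∀ y ∈ T, G.Adj x y → y = p) {u v : G.edgeSet →₀ ℕ}
    (huv : vertexMultiset u = vertexMultiset v)
    (hu : ∀ e ∈ u.support, (∀ x ∈ e.1, x ∈ S) ∨ ∀ x ∈ e.1, x ∈ T) {a b : V} (hab : G.Adj a b)
    (ha : a ∈ S) (hb : b ∈ T) (hv : (⟨s(a, b), hab⟩ : G.edgeSet) ∈ v.support) :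
    ¬ IsQuadBinomialGen (toricIdeal K G) := by
  intro h
  have key := h.forall_mem_support (P := fun e => (∀ x ∈ e, x ∈ S) ∨ ∀ x ∈ e, x ∈ T) ?_ huv hu _ hv
  · rcases key with h1 | h1
    · exact hST b (h1 b (Sym2.mem_mk_right _ _)) hb
    · exact hST a ha (h1 a (Sym2.mem_mk_left _ _))
  · intro a b c d hab hcd hac hbd h1 h2
    simp only [Sym2.mem_iff, forall_eq_or_imp, forall_eq] at h1 h2 ⊢
    rcases h1 with ⟨h1, h1'⟩ | ⟨h1, h1'⟩ <;> rcases h2 with ⟨h2, h2'⟩ | ⟨h2, h2'⟩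
    · exact Or.inl ⟨h1, h2⟩
    · rw [hadj a h1 c h2 hac, hadj b h1' d h2' hbd] at hcd
      exact absurd hcd (G.loopless.irrefl _)
    · rw [hadj c h2 a h1 hac.symm, hadj d h2' b h1' hbd.symm] at hab
      exact absurd hab (G.loopless.irrefl _)
    · exact Or.inr ⟨h1, h2⟩

theorem mem_cycVerts_of_mem_cycEdges {q : ℕ} {c : ZMod q → V} {e : Sym2 V}
    (he : e ∈ cycEdges q c) {x : V} (hx : x ∈ e) : x ∈ cycVerts q c := by
  obtain ⟨i, rfl⟩ := he
  rcases Sym2.mem_iff.1 hx with rfl | rfl <;> exact ⟨_, rfl⟩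

theorem IsQuadBinomialGen.condOddCyclesMeet (h : IsQuadBinomialGen (toricIdeal K G)) :
    CondOddCyclesMeet G := by
  rintro q₁ c₁ q₂ c₂ hc₁ ho₁ hc₂ ho₂ ⟨v, hv⟩
  by_contra! hcon
  have hv' : v ∈ cycVerts q₁ c₁ ∩ cycVerts q₂ c₂ := hv ▸ rfl
  have huniq : ∀ x, x ∈ cycVerts q₁ c₁ → x ∈ cycVerts q₂ c₂ → x = v := fun x h1 h2 =>
    (hv ▸ (⟨h1, h2⟩ : x ∈ cycVerts q₁ c₁ ∩ cycVerts q₂ c₂) : x ∈ ({v} : Set V))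
  obtain ⟨E₁, O₁, h1, h2, h3, y, hy, hyv, hyE⟩ := hc₁.1.exists_exponents ho₁ hv'.1
  obtain ⟨E₂, O₂, h4, h5, -, -⟩ := hc₂.1.exists_exponents ho₂ hv'.2
  refine not_isQuadBinomialGen_of_separated (K := K) (S := cycVerts q₁ c₁ \ {v})
    (T := cycVerts q₂ c₂) (p := v) (u := O₁ + E₂) (v := E₁ + O₂) ?_ ?_ ?_ ?_ hyv
    ⟨hy, hyv.ne⟩ hv'.2 ?_ h
  · rintro x ⟨hx, hxv⟩ hx'
    exact hxv (huniq x hx hx')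
  · rintro x ⟨hx, hxv⟩ y hy hxy
    by_contra hyv
    by_cases h6 : s(x, y) ∈ cycEdges q₁ c₁
    · exact hyv (huniq y (mem_cycVerts_of_mem_cycEdges h6 (Sym2.mem_mk_right _ _)) hy)
    · exact hxv (huniq x hx
        (mem_cycVerts_of_mem_cycEdges (hcon x y hx hy hxy h6) (Sym2.mem_mk_left _ _)))
  · rw [vertexMultiset_add, vertexMultiset_add, h1, h4]
    simp
  · classical
    intro e he
    rcases Finset.mem_union.1 (Finsupp.support_add he) with he | he
    · exact Or.inl fun x hx => h3 e he x hx
    · exact Or.inr fun x hx => h5 e he x hx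
  · rw [Finsupp.mem_support_iff] at hyE ⊢
    rw [Finsupp.add_apply]
    omega

/-- Some ratio of monomials in the edges inside `S` equals the square of the variable of `p`. -/
def HasSquareExponent (G : SimpleGraph V) (S : Set V) (p : V) : Prop :=
  ∃ u v : G.edgeSet →₀ ℕ, vertexMultiset u = p ::ₘ p ::ₘ vertexMultiset v ∧
    (∀ e ∈ u.support, ∀ x ∈ e.1, x ∈ S) ∧ ∀ e ∈ v.support, ∀ x ∈ e.1, x ∈ S

theorem HasSquareExponent.mono {S T : Set V} {p : V} (h : HasSquareExponent G S p) (hST : S ⊆ T) :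
    HasSquareExponent G T p := by
  obtain ⟨u, v, h1, h2, h3⟩ := h
  exact ⟨u, v, h1, fun e he x hx => hST (h2 e he x hx), fun e he x hx => hST (h3 e he x hx)⟩

theorem HasSquareExponent.of_adj {S : Set V} {p q : V} (h : HasSquareExponent G S p)
    (hpq : G.Adj q p) (hp : p ∈ S) (hq : q ∈ S) : HasSquareExponent G S q := by
  classical
  obtain ⟨u, v, h1, h2, h3⟩ := h
  let e₀ : G.edgeSet := ⟨s(q, p), hpq⟩
  refine ⟨v + (Finsupp.single e₀ 1 + Finsupp.single e₀ 1), u, ?_, ?_, h2⟩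
  · rw [vertexMultiset_add, vertexMultiset_add, vertexMultiset_single, h1]
    simp only [Multiset.insert_eq_cons, ← Multiset.singleton_add]
    abel
  · intro e he x hx
    rcases Finset.mem_union.1 (Finsupp.support_add he) with he | he
    · exact h3 e he x hx
    · have : e = e₀ := by
        rcases Finset.mem_union.1 (Finsupp.support_add he) with he | he <;>
          exact Finset.mem_singleton.1 (Finsupp.support_single_subset he)
      subst this
      rcases Sym2.mem_iff.1 hx with rfl | rfl
      · exact hq
      · exact hp

theorem HasSquareExponent.exists_adj {S : Set V} {z t : V} (p : G.Walk z t) (ht : t ∈ S)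
    (hz : z ∉ S ∧ ∀ a ∈ S, ¬ G.Adj a z)
    (h : HasSquareExponent G {z | z ∉ S ∧ ∀ a ∈ S, ¬ G.Adj a z} z) :
    ∃ y ∉ S, ∃ a ∈ S, G.Adj a y ∧
      HasSquareExponent G (insert y {z | z ∉ S ∧ ∀ a ∈ S, ¬ G.Adj a z}) y := by
  induction p with
  | nil => exact absurd ht hz.1
  | @cons z y _ hzy p ih =>
    have hy : y ∉ S := fun hy => hz.2 y hy hzy.symm
    have hsq : HasSquareExponent G (insert y {z | z ∉ S ∧ ∀ a ∈ S, ¬ G.Adj a z}) y :=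
      (h.mono (Set.subset_insert _ _)).of_adj hzy.symm (Set.mem_insert_of_mem _ hz)
        (Set.mem_insert _ _)
    by_cases hyS : ∃ a ∈ S, G.Adj a y
    · obtain ⟨a, ha, hay⟩ := hyS
      exact ⟨y, hy, a, ha, hay, hsq⟩
    · push Not at hyS
      rw [Set.insert_eq_of_mem (show y ∈ {z | z ∉ S ∧ ∀ a ∈ S, ¬ G.Adj a z} from ⟨hy, hyS⟩)] at hsq
      exact ih ht ⟨hy, hyS⟩ hsq

theorem IsQuadBinomialGen.not_hasSquareExponent (h : IsQuadBinomialGen (toricIdeal K G)) {q : ℕ}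
    {c : ZMod q → V} (hc : IsCycleOn' G q c) (hq : Odd q) {a p : V} (ha : a ∈ cycVerts q c)
    (hp : p ∉ cycVerts q c) (hap : G.Adj a p) :
    ¬ HasSquareExponent G
      (insert p {z | z ∉ cycVerts q c ∧ ∀ a ∈ cycVerts q c, ¬ G.Adj a z}) p := by
  classical
  rintro ⟨u, v, h1, h2, -⟩
  obtain ⟨E, O, h3, h4, -, -⟩ := hc.exists_exponents hq ha
  let e₀ : G.edgeSet := ⟨s(a, p), hap⟩
  refine not_isQuadBinomialGen_of_separated (K := K) (S := cycVerts q c)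
    (T := insert p {z | z ∉ cycVerts q c ∧ ∀ a ∈ cycVerts q c, ¬ G.Adj a z}) (p := p)
    (u := E + u) (v := O + v + (Finsupp.single e₀ 1 + Finsupp.single e₀ 1)) ?_ ?_ ?_ ?_ hap
    ha (Set.mem_insert _ _) ?_ h
  · rintro x hx (rfl | hx')
    · exact hp hx
    · exact hx'.1 hx
  · rintro x hx y (rfl | hy) hxy
    · rfl
    · exact absurd hxy (hy.2 x hx)
  · rw [vertexMultiset_add, vertexMultiset_add, vertexMultiset_add, vertexMultiset_add,
      vertexMultiset_single, h1, h3]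
    simp only [Multiset.insert_eq_cons, ← Multiset.singleton_add]
    abel
  · intro e he
    rcases Finset.mem_union.1 (Finsupp.support_add he) with he | he
    · exact Or.inl fun x hx => h4 e he x hx
    · exact Or.inr fun x hx => h2 e he x hx
  · simp [e₀]

theorem IsQuadBinomialGen.condOddCyclesDisjoint (h : IsQuadBinomialGen (toricIdeal K G))
    (hG : G.Connected) : CondOddCyclesDisjoint G := by
  rintro q₁ c₁ q₂ c₂ hc₁ ho₁ hc₂ ho₂ hdisj
  have hdisj' : ∀ x, x ∈ cycVerts q₁ c₁ → x ∉ cycVerts q₂ c₂ := fun x h1 h2 =>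
    Set.eq_empty_iff_forall_notMem.1 hdisj x ⟨h1, h2⟩
  have hsq : ∀ p ∈ cycVerts q₂ c₂, HasSquareExponent G (cycVerts q₂ c₂) p := by
    intro p hp
    obtain ⟨E, O, h1, h2, h3, -⟩ := hc₂.1.exists_exponents ho₂ hp
    exact ⟨E, O, h1, h2, fun e he x hx => (h3 e he x hx).1⟩
  by_contra hcon
  by_cases hbr : ∃ a ∈ cycVerts q₁ c₁, ∃ b ∈ cycVerts q₂ c₂, G.Adj a b
  · obtain ⟨a, ha, b, hb, hab⟩ := hbr
    refine h.not_hasSquareExponent hc₁.1 ho₁ ha (fun hb' => hdisj' b hb' hb) hab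
      ((hsq b hb).mono ?_)
    intro z hz
    by_cases hzb : z = b
    · exact Or.inl hzb
    · refine Or.inr ⟨fun hz' => hdisj' z hz' hz, fun a' ha' ha'z => hcon ?_⟩
      refine ⟨s(a, b), s(a', z), fun heq => ?_, ⟨hab, a, b, ha, hb, rfl⟩,
        ⟨ha'z, a', z, ha', hz, rfl⟩⟩
      rcases Sym2.eq_iff.1 heq with ⟨-, h1⟩ | ⟨h1, -⟩
      · exact hzb h1.symm
      · exact hdisj' a ha (h1 ▸ hz)
  · push Not at hbr
    have hsub : cycVerts q₂ c₂ ⊆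
        {z | z ∉ cycVerts q₁ c₁ ∧ ∀ a ∈ cycVerts q₁ c₁, ¬ G.Adj a z} :=
      fun z hz => ⟨fun hz' => hdisj' z hz' hz, fun a ha => hbr a ha z hz⟩
    obtain ⟨p⟩ := hG.preconnected (c₂ 0) (c₁ 0)
    have h0 : c₂ 0 ∈ cycVerts q₂ c₂ := ⟨0, rfl⟩
    obtain ⟨y, hy, a, ha, hay, hs⟩ := HasSquareExponent.exists_adj p
      (S := cycVerts q₁ c₁) ⟨0, rfl⟩ (hsub h0) ((hsq _ h0).mono hsub)
    exact h.not_hasSquareExponent hc₁.1 ho₁ ha hy hay hs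

end Necessity

/-! ### Even cycles -/

section EvenCycles

variable {V : Type*} {G : SimpleGraph V} {n : ℕ} {w : ℕ → V}

/-- The edge `e` is an edge of the closed walk `w` starting at an even position. -/
def IsEvenStep (w : ℕ → V) (e : Sym2 V) : Prop := ∃ k, e = s(w (2 * k), w (2 * k + 1))

/-- The edge `e` joins two vertices of `w` whose positions have the same parity. -/
def IsSameParity (w : ℕ → V) (e : Sym2 V) : Prop := ∃ i j, i % 2 = j % 2 ∧ e = s(w i, w j)

theorem isEvenStep_mk {w : ℕ → V} {a b : V} (h : IsEvenStep w s(a, b)) :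
    ∃ k, (a = w (2 * k) ∧ b = w (2 * k + 1)) ∨ (a = w (2 * k + 1) ∧ b = w (2 * k)) := by
  obtain ⟨k, hk⟩ := h
  exact ⟨k, Sym2.eq_iff.1 hk⟩

theorem isSameParity_mk {w : ℕ → V} {a b : V} (h : IsSameParity w s(a, b)) :
    ∃ i j, i % 2 = j % 2 ∧ a = w i ∧ b = w j := by
  obtain ⟨i, j, hij, hk⟩ := h
  rcases Sym2.eq_iff.1 hk with ⟨h1, h2⟩ | ⟨h1, h2⟩
  · exact ⟨i, j, hij, h1, h2⟩
  · exact ⟨j, i, hij.symm, h1, h2⟩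

theorem mod_eq_of_apply_eq (hn : 0 < n) (hper : ∀ k, w (k + 2 * n) = w k)
    (hinj : ∀ i d, 0 < d → d < 2 * n → w i ≠ w (i + d)) {i j : ℕ} (h : w i = w j) :
    i % (2 * n) = j % (2 * n) := by
  have hp : ∀ k, w (k % (2 * n)) = w k := (show Function.Periodic w (2 * n) from hper).map_mod_nat
  have h' : w (i % (2 * n)) = w (j % (2 * n)) := by rw [hp, hp, h]
  have hi : i % (2 * n) < 2 * n := Nat.mod_lt _ (by omega)
  have hj : j % (2 * n) < 2 * n := Nat.mod_lt _ (by omega)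
  rcases lt_trichotomy (i % (2 * n)) (j % (2 * n)) with hlt | heq | hlt
  · refine absurd ?_ (hinj (i % (2 * n)) (j % (2 * n) - i % (2 * n)) (by omega) (by omega))
    rw [h', Nat.add_sub_cancel' hlt.le]
  · exact heq
  · refine absurd ?_ (hinj (j % (2 * n)) (i % (2 * n) - j % (2 * n)) (by omega) (by omega))
    rw [← h', Nat.add_sub_cancel' hlt.le]

theorem parity_eq_of_apply_eq (hn : 0 < n) (hper : ∀ k, w (k + 2 * n) = w k)
    (hinj : ∀ i d, 0 < d → d < 2 * n → w i ≠ w (i + d)) {i j : ℕ} (h : w i = w j) :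
    i % 2 = j % 2 := by
  have h1 := mod_eq_of_apply_eq hn hper hinj h
  rw [← Nat.mod_mul_right_mod i 2 n, h1, Nat.mod_mul_right_mod]

theorem apply_add_eq (hn : 0 < n) (hper : ∀ k, w (k + 2 * n) = w k)
    (hinj : ∀ i d, 0 < d → d < 2 * n → w i ≠ w (i + d)) {i j : ℕ} (h : w i = w j) (d : ℕ) :
    w (i + d) = w (j + d) := by
  have hp : ∀ k, w (k % (2 * n)) = w k := (show Function.Periodic w (2 * n) from hper).map_mod_nat
  rw [← hp (i + d), ← hp (j + d), Nat.add_mod, mod_eq_of_apply_eq hn hper hinj h, ← Nat.add_mod]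

theorem consecutive_of_adj (hn : 0 < n) (hper : ∀ k, w (k + 2 * n) = w k)
    (hinj : ∀ i d, 0 < d → d < 2 * n → w i ≠ w (i + d)) (he : ¬ HasEvenChord G n w) {i j : ℕ}
    (hij : i % 2 ≠ j % 2) (h : G.Adj (w i) (w j)) :
    w j = w (i + 1) ∨ w i = w (j + 1) := by
  obtain ⟨p, hp1, hp2, hp, hpar⟩ := exists_mem_period_apply_eq hper hn i j
  by_contra! hcon
  refine he ⟨i, p, Nat.odd_iff.2 (by omega), ?_, ?_, hp ▸ h⟩
  · by_contra hlt
    have : p = 1 := by omega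
    exact hcon.1 (by rw [← hp, this])
  · by_contra hlt
    have hp' : p + 1 = 2 * n := by omega
    apply hcon.2
    rw [← apply_add_eq hn hper hinj hp 1, add_assoc, hp', hper]

theorem not_isEvenStep_one_two (hn : 1 < n) (hper : ∀ k, w (k + 2 * n) = w k)
    (hinj : ∀ i d, 0 < d → d < 2 * n → w i ≠ w (i + d)) : ¬ IsEvenStep w s(w 1, w 2) := by
  intro h
  obtain ⟨k, ⟨h1, -⟩ | ⟨h1, h2⟩⟩ := isEvenStep_mk h
  · have := parity_eq_of_apply_eq (by omega) hper hinj h1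
    omega
  · refine hinj (2 * k) 2 (by omega) (by omega) ?_
    rw [← h2]
    exact apply_add_eq (by omega) hper hinj h1 1

theorem not_isSameParity_one_two (hn : 0 < n) (hper : ∀ k, w (k + 2 * n) = w k)
    (hinj : ∀ i d, 0 < d → d < 2 * n → w i ≠ w (i + d)) : ¬ IsSameParity w s(w 1, w 2) := by
  intro h
  obtain ⟨i, j, hij, h1, h2⟩ := isSameParity_mk h
  have h3 := parity_eq_of_apply_eq hn hper hinj h1
  have h4 := parity_eq_of_apply_eq hn hper hinj h2
  omega

theorem isEvenStep_exchange (hn : 3 ≤ n) (hper : ∀ k, w (k + 2 * n) = w k)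
    (hinj : ∀ i d, 0 < d → d < 2 * n → w i ≠ w (i + d))
    (he : ¬ HasEvenChord G n w) {P : Sym2 V → Prop} (hP : ∀ k, P s(w (2 * k), w (2 * k + 1)))
    (hX : ∀ i j, i % 2 = j % 2 → G.Adj (w i) (w j) → G.Adj (w (i + 1)) (w (j + 1)) →
      P s(w i, w j) ∧ P s(w (i + 1), w (j + 1)))
    {a b c d : V} (hac : G.Adj a c) (hbd : G.Adj b d) (hab : IsEvenStep w s(a, b))
    (hcd : IsEvenStep w s(c, d)) : P s(a, c) := by
  have key : ∀ k l, G.Adj (w (2 * k)) (w (2 * l + 1)) → G.Adj (w (2 * k + 1)) (w (2 * l)) →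
      P s(w (2 * k), w (2 * l + 1)) := by
    intro k l h1 h2
    rcases consecutive_of_adj (by omega) hper hinj he (by omega) h1 with h | h
    · rw [h]; exact hP k
    · rw [apply_add_eq (by omega) hper hinj h 1] at h2
      exact absurd ⟨2 * l, 3, by decide, le_rfl, by omega, h2.symm⟩ he
  obtain ⟨k, ⟨rfl, rfl⟩ | ⟨rfl, rfl⟩⟩ := isEvenStep_mk hab <;>
    obtain ⟨l, ⟨rfl, rfl⟩ | ⟨rfl, rfl⟩⟩ := isEvenStep_mk hcd
  · exact (hX _ _ (by omega) hac hbd).1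
  · exact key k l hac hbd
  · rw [Sym2.eq_swap]; exact key l k hac.symm hbd.symm
  · exact (hX _ _ (by omega) hbd hac).2

theorem isEvenStep_or_isSameParity_exchange (hn : 3 ≤ n)
    (hper : ∀ k, w (k + 2 * n) = w k) (hinj : ∀ i d, 0 < d → d < 2 * n → w i ≠ w (i + d))
    (he : ¬ HasEvenChord G n w) {t : ℕ} (ht : Even t) (ht2 : 2 ≤ t) (htn : t + 2 ≤ 2 * n)
    (h3 : ∀ p d, Even d → 0 < d → d < 2 * n → G.Adj (w p) (w (p + d)) →
      s(w p, w (p + d)) = s(w 0, w t) ∨ s(w p, w (p + d)) = s(w 1, w (t + 1)))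
    {a b c d : V} (hab' : G.Adj a b) (hcd' : G.Adj c d)
    (hac : G.Adj a c) (hbd : G.Adj b d) (hab : IsEvenStep w s(a, b) ∨ IsSameParity w s(a, b))
    (hcd : IsEvenStep w s(c, d) ∨ IsSameParity w s(c, d)) :
    IsEvenStep w s(a, c) ∨ IsSameParity w s(a, c) := by
  have hn0 : 0 < n := by omega
  have ht' := Nat.even_iff.1 ht
  have hpar : ∀ {i j}, w i = w j → i % 2 = j % 2 := parity_eq_of_apply_eq hn0 hper hinj
  have hsame : ∀ i j, i % 2 = j % 2 → G.Adj (w i) (w j) →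
      s(w i, w j) = s(w 0, w t) ∨ s(w i, w j) = s(w 1, w (t + 1)) := by
    intro i j hij h
    obtain ⟨p, hp1, hp2, hp, hpp⟩ := exists_mem_period_apply_eq hper hn0 i j
    rw [← hp] at h ⊢
    refine h3 i p (Nat.even_iff.2 (by omega)) hp1 (lt_of_le_of_ne hp2 ?_) h
    rintro rfl
    rw [hper] at h
    exact G.loopless.irrefl _ h
  have heven : ∀ i j, i % 2 = 0 → j % 2 = 0 → G.Adj (w i) (w j) → s(w i, w j) = s(w 0, w t) := by
    intro i j hi hj h
    refine (hsame i j (by omega) h).resolve_right fun h' => ?_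
    rcases Sym2.eq_iff.1 h' with ⟨h1, -⟩ | ⟨-, h1⟩ <;> have := hpar h1 <;> omega
  have hodd : ∀ i j, i % 2 = 1 → j % 2 = 1 → G.Adj (w i) (w j) →
      s(w i, w j) = s(w 1, w (t + 1)) := by
    intro i j hi hj h
    refine (hsame i j (by omega) h).resolve_left fun h' => ?_
    rcases Sym2.eq_iff.1 h' with ⟨h1, -⟩ | ⟨-, h1⟩ <;> have := hpar h1 <;> omega
  have huniq : ∀ i j k l, i % 2 = j % 2 → k % 2 = j % 2 → l % 2 = j % 2 → G.Adj (w i) (w j) →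
      G.Adj (w k) (w l) → s(w i, w j) = s(w k, w l) := by
    intro i j k l h1 h2 h3 h4 h5
    rcases Nat.mod_two_eq_zero_or_one j with hj | hj
    · rw [heven i j (by omega) hj h4, heven k l (by omega) (by omega) h5]
    · rw [hodd i j (by omega) hj h4, hodd k l (by omega) (by omega) h5]
  have hcross : G.Adj (w 0) (w (t + 1)) → G.Adj (w t) (w 1) → False := by
    intro h1 h2
    have hne : w 1 ≠ w (t + 1) := by
      rw [add_comm t 1]; exact hinj 1 t (by omega) (by omega)
    have h4 := (consecutive_of_adj hn0 hper hinj he (by omega) h1).resolve_left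
      (by simpa using hne.symm)
    have h5 := (consecutive_of_adj hn0 hper hinj he (by omega) h2).resolve_left hne
    have h6 := mod_eq_of_apply_eq hn0 hper hinj h5
    rw [Nat.mod_eq_of_lt (by omega), Nat.mod_eq_of_lt (by omega)] at h6
    subst h6
    exact hinj 0 4 (by omega) (by omega) h4
  have hmixed : ∀ a b c d : V, G.Adj c d → G.Adj a c → G.Adj b d → IsEvenStep w s(a, b) →
      IsSameParity w s(c, d) → IsEvenStep w s(a, c) ∨ IsSameParity w s(a, c) := by
    intro a b c d hcd' hac hbd hab hcd
    obtain ⟨k, l, hkl, rfl, rfl⟩ := isSameParity_mk hcd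
    obtain ⟨i, j, rfl, rfl, hij⟩ : ∃ i j, a = w i ∧ b = w j ∧ i % 2 ≠ j % 2 := by
      obtain ⟨k, ⟨rfl, rfl⟩ | ⟨rfl, rfl⟩⟩ := isEvenStep_mk hab
      · exact ⟨_, _, rfl, rfl, by omega⟩
      · exact ⟨_, _, rfl, rfl, by omega⟩
    by_cases hik : i % 2 = k % 2
    · exact Or.inr ⟨i, k, hik, rfl⟩
    · rcases Sym2.eq_iff.1 (huniq j l k l (by omega) (by omega) rfl hbd hcd') with ⟨h, -⟩ | ⟨-, h⟩
      · exact Or.inl (h ▸ hab)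
      · exact absurd h hcd'.ne'
  have hsteps : ∀ a b c d : V, G.Adj a b → G.Adj c d → G.Adj a c → G.Adj b d →
      s(a, b) = s(w 0, w t) → s(c, d) = s(w 1, w (t + 1)) → IsEvenStep w s(a, c) := by
    intro a b c d hab' hcd' hac hbd hab hcd
    rcases Sym2.eq_iff.1 hab with ⟨rfl, rfl⟩ | ⟨rfl, rfl⟩ <;>
      rcases Sym2.eq_iff.1 hcd with ⟨rfl, rfl⟩ | ⟨rfl, rfl⟩
    · exact ⟨0, rfl⟩
    · exact (hcross hac hbd).elim
    · exact (hcross hbd hac).elim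
    · exact ⟨t / 2, by rw [Nat.two_mul_div_two_of_even ht]⟩
  rcases hab with hab | hab <;> rcases hcd with hcd | hcd
  · refine isEvenStep_exchange hn hper hinj he (P := fun e => IsEvenStep w e ∨ IsSameParity w e)
      (fun k => Or.inl ⟨k, rfl⟩) (fun i j hij _ _ => ⟨Or.inr ⟨i, j, hij, rfl⟩,
        Or.inr ⟨i + 1, j + 1, by omega, rfl⟩⟩) hac hbd hab hcd
  · exact hmixed a b c d hcd' hac hbd hab hcd
  · rw [Sym2.eq_swap]; exact hmixed c d a b hab' hac.symm hbd.symm hcd hab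
  · obtain ⟨i, j, hij, rfl, rfl⟩ := isSameParity_mk hab
    obtain ⟨k, l, hkl, rfl, rfl⟩ := isSameParity_mk hcd
    by_cases hik : i % 2 = k % 2
    · exact Or.inr ⟨i, k, hik, rfl⟩
    · left
      rcases Nat.mod_two_eq_zero_or_one i with hi | hi
      · exact hsteps _ _ _ _ hab' hcd' hac hbd (heven i j hi (by omega) hab')
          (hodd k l (by omega) (by omega) hcd')
      · rw [Sym2.eq_swap]
        exact hsteps _ _ _ _ hcd' hab' hac.symm hbd.symm (heven k l (by omega) (by omega) hcd')
          (hodd i j hi (by omega) hab')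

variable {K : Type*} [Field K]

/-- An even closed walk cannot be rewritten by quadratic moves if a property of edges which is
stable under quadratic moves separates its even steps from the others. -/
theorem IsQuadBinomialGen.apply_of_isEvenStep (h : IsQuadBinomialGen (toricIdeal K G))
    (hn : 0 < n) (hadj : ∀ k, G.Adj (w k) (w (k + 1))) (hper : ∀ k, w (k + 2 * n) = w k)
    {P : Sym2 V → Prop}
    (hP : ∀ a b c d, G.Adj a b → G.Adj c d → G.Adj a c → G.Adj b d → P s(a, b) → P s(c, d) →
      P s(a, c)) (hstep : ∀ e, IsEvenStep w e → P e) : P s(w 1, w 2) := by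
  have huv : vertexMultiset (altExponent hadj 0 n) = vertexMultiset (altExponent hadj 1 n) := by
    rw [vertexMultiset_altExponent, vertexMultiset_altExponent]
    obtain ⟨m, hm⟩ : ∃ m, 2 * n = m + 1 := ⟨2 * n - 1, by omega⟩
    rw [hm, map_range_succ_eq_cons, Multiset.range_succ, Multiset.map_cons, add_comm 1 m, ← hm,
      ← hper 0]
    simp only [zero_add]
  refine h.forall_mem_support hP huv ?_ _ (mem_support_altExponent hadj (a := 1) hn)
  intro e he
  obtain ⟨k, -, hk⟩ := exists_of_mem_support_altExponent hadj he
  rw [zero_add] at hk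
  exact hstep _ ⟨k, hk⟩

theorem IsQuadBinomialGen.condEvenCycles (h : IsQuadBinomialGen (toricIdeal K G)) :
    CondEvenCycles G := by
  rw [condEvenCycles_iff]
  intro n w hn hadj hper hinj
  by_contra! hcon
  obtain ⟨he, hc⟩ := hcon
  have hn0 : 0 < n := by omega
  by_cases hA : ∀ i j, i % 2 = j % 2 → G.Adj (w i) (w j) → ¬ G.Adj (w (i + 1)) (w (j + 1))
  · have key := h.apply_of_isEvenStep hn0 hadj hper (P := IsEvenStep w)
      (fun a b c d _ _ hac hbd hab hcd => isEvenStep_exchange hn hper hinj he (fun k => ⟨k, rfl⟩)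
        (fun i j hij h1 h2 => (hA i j hij h1 h2).elim) hac hbd hab hcd) fun _ => id
    exact not_isEvenStep_one_two (by omega) hper hinj key
  · push Not at hA
    obtain ⟨r, j, hrj, h1, h2⟩ := hA
    obtain ⟨t, ht1, ht2, ht, htp⟩ := exists_mem_period_apply_eq hper hn0 r j
    rw [← apply_add_eq hn0 hper hinj ht 1] at h2
    rw [← ht] at h1
    have htn : t ≠ 2 * n := by
      rintro rfl
      rw [hper] at h1
      exact G.loopless.irrefl _ h1
    have hte : t % 2 = 0 := by omega
    have hper' : ∀ k, w (r + (k + 2 * n)) = w (r + k) := fun k => by rw [← add_assoc, hper]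
    have hinj' : ∀ i d, 0 < d → d < 2 * n → w (r + i) ≠ w (r + (i + d)) := fun i d h h' => by
      rw [← add_assoc]
      exact hinj _ _ h h'
    have he' : ¬ HasEvenChord G n fun k => w (r + k) := by
      rintro ⟨i, d, hd, hd1, hd2, hid⟩
      refine he ⟨r + i, d, hd, hd1, hd2, ?_⟩
      rwa [add_assoc]
    have key := h.apply_of_isEvenStep (w := fun k => w (r + k)) hn0 (fun k => hadj (r + k)) hper'
      (P := fun e => IsEvenStep (fun k => w (r + k)) e ∨ IsSameParity (fun k => w (r + k)) e)
      (fun a b c d hab' hcd' hac hbd hab hcd =>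
        isEvenStep_or_isSameParity_exchange hn hper' hinj' he' (Nat.even_iff.2 hte) (by omega)
          (by omega) ?_ hab' hcd' hac hbd hab hcd) fun _ => Or.inl
    · exact key.elim (not_isEvenStep_one_two (w := fun k => w (r + k)) (by omega) hper' hinj')
        (not_isSameParity_one_two (w := fun k => w (r + k)) hn0 hper' hinj')
    · intro p d hd hd0 hdn hpd
      by_contra! hne
      refine hc ⟨r, t, Nat.even_iff.2 hte, by omega, by omega, h1, h2, r + p, d, hd, hd0, hdn, ?_⟩
      rw [add_assoc, add_assoc]
      exact ⟨hpd, hne.1, hne.2⟩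

end EvenCycles

/-- `I_G` is generated by quadratic binomials if and only if `G` satisfies the three
conditions (i), (ii), (iii) of Proposition 1.2. -/
theorem quadGen_iff_conditions {V : Type*} [Fintype V] (K : Type*) [Field K]
    (G : SimpleGraph V) (hG : G.Connected) :
    IsQuadBinomialGen (toricIdeal K G) ↔
      CondEvenCycles G ∧ CondOddCyclesMeet G ∧ CondOddCyclesDisjoint G := by
  exact ⟨fun h => ⟨h.condEvenCycles, h.condOddCyclesMeet, h.condOddCyclesDisjoint hG⟩,
    fun ⟨hc, hm, hd⟩ => isQuadBinomialGen_of_cond K hc hm hd⟩
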